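/- Let Ω ⊆ ℝⁿ, n ≥ 2, be open and bounded. Then for every u ∈ W^{2,1}_{Δ,0}(Ω) and every t with 0 < t ≤ |Ω| one has u*(t) ≤ 2^{−2/n} · N*_{|Ω|}(t) · ‖Δu‖_{L¹(Ω)}. Moreover, when n ≥ 3 the same inequality holds for Ω unbounded (with N*_∞ in place of N*_{|Ω|} if |Ω| = ∞). -/

import Mathlib

open MeasureTheory Filter Topology
open scoped ENNReal

noncomputable section

/-- Euclidean space ℝⁿ. -/
abbrev Euc (n : ℕ) := EuclideanSpace ℝ (Fin n)

/-- The (pointwise) Laplacian of a function on ℝⁿ: the trace of the second derivative. -/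
def lapl (n : ℕ) (φ : Euc n → ℝ) (x : Euc n) : ℝ :=
  ∑ i : Fin n,
    iteratedFDeriv ℝ 2 φ x ![EuclideanSpace.single i (1 : ℝ), EuclideanSpace.single i (1 : ℝ)]

/-- A test function on Ω: smooth and compactly supported inside Ω. -/
def IsTestFun (n : ℕ) (Ω : Set (Euc n)) (φ : Euc n → ℝ) : Prop :=
  ContDiff ℝ (⊤ : ℕ∞) φ ∧ HasCompactSupport φ ∧ tsupport φ ⊆ Ω

/-- `u ∈ W₀^{1,1}(Ω)`: `u` is an L¹(Ω) limit of test functions whose gradients converge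
in L¹(Ω) (i.e. `u` is in the closure of C_c^∞(Ω) in the W^{1,1} norm). -/
def MemW0_1_1 (n : ℕ) (Ω : Set (Euc n)) (u : Euc n → ℝ) : Prop :=
  IntegrableOn u Ω volume ∧
  ∃ φ : ℕ → Euc n → ℝ, (∀ k, IsTestFun n Ω (φ k)) ∧
    Tendsto (fun k => ∫ x in Ω, |φ k x - u x|) atTop (𝓝 0) ∧
    ∃ g : Euc n → Euc n →L[ℝ] ℝ,
      IntegrableOn (fun x => ‖g x‖) Ω volume ∧
      Tendsto (fun k => ∫ x in Ω, ‖fderiv ℝ (φ k) x - g x‖) atTop (𝓝 0)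

/-- `u ∈ W^{2,1}_Δ(Ω)` with distributional Laplacian `f ∈ L¹(Ω)`. -/
def MemW21Delta (n : ℕ) (Ω : Set (Euc n)) (u f : Euc n → ℝ) : Prop :=
  MemW0_1_1 n Ω u ∧ IntegrableOn f Ω volume ∧
    ∀ ψ : Euc n → ℝ, IsTestFun n Ω ψ →
      ∫ x in Ω, u x * lapl n ψ x = ∫ x in Ω, f x * ψ x

/-- `u ∈ W^{2,1}_{Δ,0}(Ω)` with Laplacian `f`: `u` is an L¹(Ω) limit of test functions `φ k`
with `Δ(φ k) → f` in L¹(Ω) (closure of C_c^∞(Ω) in the norm ‖Δu‖₁). -/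
def MemW21Delta0 (n : ℕ) (Ω : Set (Euc n)) (u f : Euc n → ℝ) : Prop :=
  IntegrableOn u Ω volume ∧ IntegrableOn f Ω volume ∧
  ∃ φ : ℕ → Euc n → ℝ, (∀ k, IsTestFun n Ω (φ k)) ∧
    Tendsto (fun k => ∫ x in Ω, |φ k x - u x|) atTop (𝓝 0) ∧
    Tendsto (fun k => ∫ x in Ω, |lapl n (φ k) x - f x|) atTop (𝓝 0)

/-- The decreasing rearrangement `u*(t)` of `u` on Ω. -/
def decRearr (n : ℕ) (Ω : Set (Euc n)) (u : Euc n → ℝ) (t : ℝ) : ℝ :=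
  sInf {s : ℝ | 0 ≤ s ∧ volume {x ∈ Ω | s < |u x|} ≤ ENNReal.ofReal t}

/-- `‖f‖_{L¹(Ω)}`. -/
def L1norm (n : ℕ) (Ω : Set (Euc n)) (f : Euc n → ℝ) : ℝ := ∫ x in Ω, |f x|

/-- ω_{n-1}: surface measure of the unit sphere in ℝⁿ. -/
def omegaS (n : ℕ) : ℝ := 2 * Real.pi ^ ((n : ℝ) / 2) / Real.Gamma ((n : ℝ) / 2)

/-- c_n = 1/((n-2) ω_{n-1}). -/
def cConst (n : ℕ) : ℝ := 1 / (((n : ℝ) - 2) * omegaS n)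

/-- `N*_V(t)`: the rearrangement of the Green function of the ball of volume V. -/
def NstarV (n : ℕ) (V t : ℝ) : ℝ :=
  if n = 2 then (1 / (4 * Real.pi)) * Real.log (V / t)
  else cConst n * (omegaS n / (n : ℝ)) ^ (((n : ℝ) - 2) / (n : ℝ)) *
    (t ^ (-(((n : ℝ) - 2) / (n : ℝ))) - V ^ (-(((n : ℝ) - 2) / (n : ℝ))))

/-- `N*_∞(t)` (for n ≥ 3). -/
def NstarInf (n : ℕ) (t : ℝ) : ℝ :=
  cConst n * (omegaS n / (n : ℝ)) ^ (((n : ℝ) - 2) / (n : ℝ)) *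
    t ^ (-(((n : ℝ) - 2) / (n : ℝ)))

/-- The maximal function `u**(t) = (1/t) ∫₀ᵗ u*(s) ds`. -/
def maximalFn (n : ℕ) (Ω : Set (Euc n)) (u : Euc n → ℝ) (t : ℝ) : ℝ :=
  (1 / t) * ∫ s in (0:ℝ)..t, decRearr n Ω u s

/-- `u ∈ L_exp(Ω)`. -/
def MemLexp (n : ℕ) (Ω : Set (Euc n)) (u : Euc n → ℝ) : Prop :=
  ∃ M : ℝ, ∀ t : ℝ, 0 < t → t ≤ (volume Ω).toReal →
    decRearr n Ω u t / (1 + Real.log ((volume Ω).toReal / t)) ≤ M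

/-- `u ∈ L_{exp,0}(Ω)`. -/
def MemLexp0 (n : ℕ) (Ω : Set (Euc n)) (u : Euc n → ℝ) : Prop :=
  MemLexp n Ω u ∧
    Tendsto (fun t : ℝ => maximalFn n Ω u t / Real.log (1 / t)) (𝓝[>] 0) (𝓝 0)

/-- `u ∈ L^{n/(n-2),∞}(Ω)`. -/
def MemWeakL (n : ℕ) (Ω : Set (Euc n)) (u : Euc n → ℝ) : Prop :=
  ∃ M : ℝ, ∀ t : ℝ, 0 < t → t ≤ (volume Ω).toReal →
    t ^ (((n : ℝ) - 2) / (n : ℝ)) * decRearr n Ω u t ≤ M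

/-- `u ∈ L₀^{n/(n-2),∞}(Ω)`. -/
def MemWeakL0 (n : ℕ) (Ω : Set (Euc n)) (u : Euc n → ℝ) : Prop :=
  MemWeakL n Ω u ∧
    Tendsto (fun t : ℝ => t ^ (((n : ℝ) - 2) / (n : ℝ)) * maximalFn n Ω u t) (𝓝[>] 0) (𝓝 0)

/-- `Λ_n^0(Ω)`: equals `L_{exp,0}(Ω)` if n = 2 and `L₀^{n/(n-2),∞}(Ω)` if n ≥ 3. -/
def MemLambda0 (n : ℕ) (Ω : Set (Euc n)) (u : Euc n → ℝ) : Prop :=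
  if n = 2 then MemLexp0 n Ω u else MemWeakL0 n Ω u

theorem add_volume_le_of_add_mem {A B C : Set ℝ} (hA : MeasurableSet A) (hB : MeasurableSet B)
    (hA0 : A.Nonempty) (hB0 : B.Nonempty) (h : ∀ x ∈ A, ∀ y ∈ B, x + y ∈ C) :
    volume A + volume B ≤ volume C := by
  obtain ⟨a₀, ha₀⟩ := hA0
  obtain ⟨b₀, hb₀⟩ := hB0
  have key : ∀ K L : Set ℝ, IsCompact K → IsCompact L → K.Nonempty → L.Nonempty → K ⊆ A → L ⊆ B →
      volume K + volume L ≤ volume C := by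
    intro K L hK hL hK0 hL0 hKA hLB
    obtain ⟨a, ha⟩ := hK.exists_isGreatest hK0
    obtain ⟨b, hb⟩ := hL.exists_isLeast hL0
    have h1 : volume ((fun x => x + b) '' K) = volume K := by
      simp
    have h2 : volume ((fun x => a + x) '' L) = volume L := by
      simp
    have hd : AEDisjoint volume ((fun x => x + b) '' K) ((fun x => a + x) '' L) := by
      refine measure_mono_null (t := {a + b}) ?_ (by simp)
      rintro z ⟨⟨x, hx, rfl⟩, ⟨y, hy, hxy⟩⟩
      have := ha.2 hx
      have := hb.2 hy
      simp only at hxy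
      simp only [Set.mem_singleton_iff]
      linarith
    have hm : MeasurableSet ((fun x => a + x) '' L) :=
      (hL.image (by fun_prop)).measurableSet
    rw [← h1, ← h2, ← measure_union₀ hm.nullMeasurableSet hd]
    apply measure_mono
    rintro z (⟨x, hx, rfl⟩ | ⟨y, hy, rfl⟩)
    · exact h x (hKA hx) b (hLB hb.1)
    · exact h a (hKA ha.1) y (hLB hy)
  rw [hA.measure_eq_iSup_isCompact, hB.measure_eq_iSup_isCompact]
  simp only [iSup_and']
  refine ENNReal.biSup_add_biSup_le' (p := fun K => K ⊆ A ∧ IsCompact K)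
    (q := fun K => K ⊆ B ∧ IsCompact K) ⟨∅, by simp, isCompact_empty⟩
    ⟨∅, by simp, isCompact_empty⟩ ?_
  rintro K ⟨hKA, hK⟩ L ⟨hLB, hL⟩
  refine le_trans (add_le_add (measure_mono (Set.subset_insert a₀ K))
    (measure_mono (Set.subset_insert b₀ L))) (key _ _ (hK.insert _) (hL.insert _)
      (Set.insert_nonempty _ _) (Set.insert_nonempty _ _) ?_ ?_)
  · exact Set.insert_subset ha₀ hKA
  · exact Set.insert_subset hb₀ hLB

theorem lintegral_eq_lintegral_Ioo_meas_lt {α : Type*} [MeasureSpace α] {f : α → ℝ}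
    (hf : Measurable f) (h0 : ∀ x, 0 ≤ f x) (h1 : ∀ x, f x ≤ 1) :
    ∫⁻ x, ENNReal.ofReal (f x) = ∫⁻ τ in Set.Ioo (0 : ℝ) 1, volume {x | τ < f x} := by
  rw [lintegral_eq_lintegral_meas_lt _ (Eventually.of_forall h0) hf.aemeasurable,
    ← Set.Ioo_union_Ici_eq_Ioi (zero_lt_one' ℝ), lintegral_union measurableSet_Ici]
  · have : ∫⁻ τ in Set.Ici (1 : ℝ), (volume {x | τ < f x} : ℝ≥0∞) = 0 := by
      rw [setLIntegral_congr_fun (g := fun _ => 0) measurableSet_Ici]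
      · simp
      · intro τ hτ
        have : {x | τ < f x} = ∅ := by
          ext x
          simpa using (h1 x).trans hτ
        simp [this]
    rw [this, add_zero]
  · rw [Set.disjoint_left]
    intro x hx hx'
    exact absurd hx.2 (not_lt.mpr hx')

theorem prekopa_leindler_normalized {p q : ℝ} (hp : 0 < p) (hq : 0 < q)
    {f g : ℝ → ℝ} {h : ℝ → ℝ≥0∞} (hf : Measurable f) (hg : Measurable g) (hh : Measurable h)
    (hf0 : ∀ x, 0 ≤ f x) (hf1 : ∀ x, f x ≤ 1) (hg0 : ∀ x, 0 ≤ g x) (hg1 : ∀ x, g x ≤ 1)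
    (hfs : ∀ τ < 1, ∃ x, τ < f x) (hgs : ∀ τ < 1, ∃ x, τ < g x)
    (hfg : ∀ τ : ℝ, 0 < τ → τ < 1 → ∀ x y, τ < f x → τ < g y →
      ENNReal.ofReal τ < h (p * x + q * y)) :
    ENNReal.ofReal p * (∫⁻ x, ENNReal.ofReal (f x)) +
      ENNReal.ofReal q * (∫⁻ x, ENNReal.ofReal (g x)) ≤ ∫⁻ x, h x := by
  set k : ℝ → ℝ := fun x => (min (h x) 1).toReal with hk
  have hkm : Measurable k := (hh.min measurable_const).ennreal_toReal
  have hk1 : ∀ x, k x ≤ 1 := fun x => by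
    have := ENNReal.toReal_mono (b := 1) (by simp) (min_le_right (h x) 1)
    simpa using this
  have hkh : ∫⁻ x, ENNReal.ofReal (k x) ≤ ∫⁻ x, h x := by
    apply lintegral_mono
    intro x
    simp only [hk]
    rw [ENNReal.ofReal_toReal (ne_top_of_le_ne_top (by simp) (min_le_right (h x) 1))]
    exact min_le_left _ _
  refine le_trans ?_ hkh
  rw [lintegral_eq_lintegral_Ioo_meas_lt hf hf0 hf1, lintegral_eq_lintegral_Ioo_meas_lt hg hg0 hg1,
    lintegral_eq_lintegral_Ioo_meas_lt hkm (fun x => ENNReal.toReal_nonneg) hk1,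
    ← lintegral_const_mul' _ _ (by simp), ← lintegral_const_mul' _ _ (by simp),
    ← lintegral_add_left']
  · refine setLIntegral_mono' measurableSet_Ioo ?_
    rintro τ ⟨h0, h1⟩
    have hscale : ∀ (c : ℝ), 0 < c → ∀ s : Set ℝ,
        ENNReal.ofReal c * volume s = volume ((fun x => c * x) '' s) := by
      intro c hc s
      have := Measure.addHaar_smul (volume : Measure ℝ) c s
      simp only [Module.finrank_self, pow_one, abs_of_pos hc] at this
      rw [← this]
      rfl
    rw [hscale p hp, hscale q hq]
    obtain ⟨x₀, hx₀⟩ := hfs τ h1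
    obtain ⟨y₀, hy₀⟩ := hgs τ h1
    refine add_volume_le_of_add_mem ?_ ?_ ?_ ?_ ?_
    · exact (measurableEmbedding_mulLeft₀ hp.ne').measurableSet_image.mpr
        (measurableSet_lt measurable_const hf)
    · exact (measurableEmbedding_mulLeft₀ hq.ne').measurableSet_image.mpr
        (measurableSet_lt measurable_const hg)
    · exact ⟨_, x₀, hx₀, rfl⟩
    · exact ⟨_, y₀, hy₀, rfl⟩
    · rintro _ ⟨x, hx, rfl⟩ _ ⟨y, hy, rfl⟩
      have h2 := hfg τ h0 h1 x y hx hy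
      have hfin : min (h (p * x + q * y)) 1 ≠ ⊤ := ne_top_of_le_ne_top (by simp) (min_le_right _ 1)
      change τ < ENNReal.toReal (min _ _)
      rw [← ENNReal.ofReal_lt_iff_lt_toReal h0.le hfin]
      refine lt_min h2 ?_
      simpa using h1
  · apply AEMeasurable.const_mul
    apply Measurable.aemeasurable
    have : Antitone fun τ : ℝ => volume {x | τ < f x} := fun a b hab =>
      measure_mono fun x (hx : b < f x) => lt_of_le_of_lt hab hx
    exact this.measurable

theorem ENNReal.rpow_mul_rpow_le_add {p q : ℝ} (hp : 0 < p) (hq : 0 < q) (hpq : p + q = 1)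
    (a b : ℝ≥0∞) : a ^ p * b ^ q ≤ ENNReal.ofReal p * a + ENNReal.ofReal q * b := by
  have hc : (p⁻¹).HolderConjugate q⁻¹ := by
    rw [Real.holderConjugate_iff]
    constructor
    · rw [one_lt_inv₀ hp]; linarith
    · simpa using hpq
  have := ENNReal.young_inequality (a ^ p) (b ^ q) hc
  rw [← ENNReal.rpow_mul, ← ENNReal.rpow_mul, mul_inv_cancel₀ hp.ne', mul_inv_cancel₀ hq.ne',
    ENNReal.rpow_one, ENNReal.rpow_one, ENNReal.ofReal_inv_of_pos hp, ENNReal.ofReal_inv_of_pos hq,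
    div_eq_mul_inv, div_eq_mul_inv, inv_inv, inv_inv] at this
  rw [mul_comm (ENNReal.ofReal p), mul_comm (ENNReal.ofReal q)]
  exact this

theorem prekopa_leindler_bounded {p q : ℝ} (hp : 0 < p) (hq : 0 < q) (hpq : p + q = 1)
    {f g h : ℝ → ℝ≥0∞} (hf : Measurable f) (hg : Measurable g) (hh : Measurable h)
    {M : ℝ≥0∞} (hM : M ≠ ⊤) (hfM : ∀ x, f x ≤ M) (hgM : ∀ x, g x ≤ M)
    (hfg : ∀ x y, f x ^ p * g y ^ q ≤ h (p * x + q * y)) :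
    (∫⁻ x, f x) ^ p * (∫⁻ x, g x) ^ q ≤ ∫⁻ x, h x := by
  set a := ⨆ x, f x with ha
  set b := ⨆ x, g x with hb
  have haT : a ≠ ⊤ := ne_top_of_le_ne_top hM (iSup_le hfM)
  have hbT : b ≠ ⊤ := ne_top_of_le_ne_top hM (iSup_le hgM)
  rcases eq_or_ne a 0 with ha0 | ha0
  · have : ∀ x, f x = 0 := by simpa [ha] using ha0
    simp [this, hp]
  rcases eq_or_ne b 0 with hb0 | hb0
  · have : ∀ x, g x = 0 := by simpa [hb] using hb0
    simp [this, hq]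
  have hfa : ∀ x, f x / a ≤ 1 := fun x => ENNReal.div_le_of_le_mul (by simpa using le_iSup f x)
  have hgb : ∀ x, g x / b ≤ 1 := fun x => ENNReal.div_le_of_le_mul (by simpa using le_iSup g x)
  have hfaT : ∀ x, f x / a ≠ ⊤ := fun x => ne_top_of_le_ne_top (by simp) (hfa x)
  have hgbT : ∀ x, g x / b ≠ ⊤ := fun x => ne_top_of_le_ne_top (by simp) (hgb x)
  set c := a ^ p * b ^ q with hc
  have hc0 : c ≠ 0 := mul_ne_zero (by simp [ENNReal.rpow_eq_zero_iff, ha0, haT])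
    (by simp [ENNReal.rpow_eq_zero_iff, hb0, hbT])
  have hcT : c ≠ ⊤ := ENNReal.mul_ne_top (ENNReal.rpow_ne_top_of_nonneg hp.le haT)
    (ENNReal.rpow_ne_top_of_nonneg hq.le hbT)
  have exist : ∀ (f : ℝ → ℝ≥0∞), (⨆ x, f x) ≠ 0 → (⨆ x, f x) ≠ ⊤ → (∀ x, f x / (⨆ x, f x) ≠ ⊤) →
      ∀ τ < (1 : ℝ), ∃ x, τ < (f x / (⨆ x, f x)).toReal := by
    intro f h0 hT hfT τ hτ
    have : ENNReal.ofReal τ * (⨆ x, f x) < ⨆ x, f x := by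
      calc _ < 1 * (⨆ x, f x) := by
            rw [ENNReal.mul_lt_mul_iff_left h0 hT]
            simpa using hτ
        _ = _ := one_mul _
    obtain ⟨x, hx⟩ := lt_iSup_iff.mp this
    refine ⟨x, ?_⟩
    rw [← ENNReal.lt_div_iff_mul_lt (Or.inl h0) (Or.inl hT)] at hx
    rw [← ENNReal.ofReal_toReal (hfT x)] at hx
    exact (ENNReal.ofReal_lt_ofReal_iff'.mp hx).1
  have key := prekopa_leindler_normalized hp hq (f := fun x => (f x / a).toReal)
    (g := fun x => (g x / b).toReal) (h := fun x => h x / c)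
    (hf.div_const _).ennreal_toReal (hg.div_const _).ennreal_toReal (hh.div_const _)
    (fun x => ENNReal.toReal_nonneg)
    (fun x => by simpa using ENNReal.toReal_mono (b := 1) (by simp) (hfa x))
    (fun x => ENNReal.toReal_nonneg)
    (fun x => by simpa using ENNReal.toReal_mono (b := 1) (by simp) (hgb x))
    (exist f ha0 haT hfaT) (exist g hb0 hbT hgbT) ?_
  · simp only [ENNReal.ofReal_toReal (hfaT _), ENNReal.ofReal_toReal (hgbT _)] at key
    have h3 := (ENNReal.rpow_mul_rpow_le_add hp hq hpq _ _).trans key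
    simp only [div_eq_mul_inv] at h3
    rw [lintegral_mul_const _ hf, lintegral_mul_const _ hg, lintegral_mul_const _ hh,
      ENNReal.mul_rpow_of_nonneg _ _ hp.le, ENNReal.mul_rpow_of_nonneg _ _ hq.le,
      ENNReal.inv_rpow, ENNReal.inv_rpow, mul_mul_mul_comm, ← ENNReal.mul_inv, ← hc] at h3
    · rwa [ENNReal.mul_le_mul_iff_left] at h3
      · simpa using hcT
      · simpa using hc0
    · exact Or.inl (by simp [ENNReal.rpow_eq_zero_iff, ha0, haT])
    · exact Or.inl (ENNReal.rpow_ne_top_of_nonneg hp.le haT)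
  · intro τ h0 h1 x y hx hy
    rw [← ENNReal.ofReal_lt_iff_lt_toReal h0.le (hfaT x),
      ENNReal.lt_div_iff_mul_lt (Or.inl ha0) (Or.inl haT)] at hx
    rw [← ENNReal.ofReal_lt_iff_lt_toReal h0.le (hgbT y),
      ENNReal.lt_div_iff_mul_lt (Or.inl hb0) (Or.inl hbT)] at hy
    rw [ENNReal.lt_div_iff_mul_lt (Or.inl hc0) (Or.inl hcT)]
    refine lt_of_lt_of_le ?_ (hfg x y)
    have : ENNReal.ofReal τ * c = (ENNReal.ofReal τ * a) ^ p * (ENNReal.ofReal τ * b) ^ q := by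
      rw [ENNReal.mul_rpow_of_nonneg _ _ hp.le, ENNReal.mul_rpow_of_nonneg _ _ hq.le,
        mul_mul_mul_comm, ← ENNReal.rpow_add_of_nonneg _ _ hp.le hq.le, hpq, ENNReal.rpow_one]
    rw [this]
    exact ENNReal.mul_lt_mul (ENNReal.rpow_lt_rpow hx hp) (ENNReal.rpow_lt_rpow hy hq)

theorem tendsto_lintegral_min_natCast {α : Type*} [MeasurableSpace α] {μ : Measure α}
    {f : α → ℝ≥0∞} (hf : Measurable f) :
    Tendsto (fun k : ℕ => ∫⁻ x, min (f x) k ∂μ) atTop (𝓝 (∫⁻ x, f x ∂μ)) := by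
  refine lintegral_tendsto_of_tendsto_of_monotone (fun k => (hf.min measurable_const).aemeasurable)
    (Eventually.of_forall fun x i j hij => ?_) (Eventually.of_forall fun x => ?_)
  · exact min_le_min le_rfl (by exact_mod_cast hij)
  · have : Tendsto (fun k : ℕ => min (f x) (k : ℝ≥0∞)) atTop (𝓝 (min (f x) ⊤)) :=
      tendsto_const_nhds.min ENNReal.tendsto_nat_nhds_top
    simpa using this

theorem prekopa_leindler_real {p q : ℝ} (hp : 0 < p) (hq : 0 < q) (hpq : p + q = 1)
    {f g h : ℝ → ℝ≥0∞} (hf : Measurable f) (hg : Measurable g) (hh : Measurable h)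
    (hfg : ∀ x y, f x ^ p * g y ^ q ≤ h (p * x + q * y)) :
    (∫⁻ x, f x) ^ p * (∫⁻ x, g x) ^ q ≤ ∫⁻ x, h x := by
  rcases eq_or_ne (∫⁻ x, f x) 0 with hf0 | hf0
  · simp [hf0, hp]
  rcases eq_or_ne (∫⁻ x, g x) 0 with hg0 | hg0
  · simp [hg0, hq]
  have h1 := ((ENNReal.continuous_rpow_const (y := p)).tendsto _).comp
    (tendsto_lintegral_min_natCast (μ := volume) hf)
  have h2 := ((ENNReal.continuous_rpow_const (y := q)).tendsto _).comp
    (tendsto_lintegral_min_natCast (μ := volume) hg)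
  refine le_of_tendsto' (ENNReal.Tendsto.mul h1 (Or.inl ?_) h2 (Or.inl ?_)) fun k => ?_
  · simp [ENNReal.rpow_eq_zero_iff, hf0, hp.le]
  · simp [ENNReal.rpow_eq_zero_iff, hg0, hq.le]
  · refine prekopa_leindler_bounded hp hq hpq (hf.min measurable_const) (hg.min measurable_const)
      hh (ENNReal.natCast_ne_top k) (fun x => min_le_right _ _) (fun x => min_le_right _ _) ?_
    intro x y
    refine le_trans (mul_le_mul' ?_ ?_) (hfg x y)
    · exact ENNReal.rpow_le_rpow (min_le_left _ _) hp.le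
    · exact ENNReal.rpow_le_rpow (min_le_left _ _) hq.le

theorem lintegral_fin_succ {n : ℕ} {f : (Fin (n + 1) → ℝ) → ℝ≥0∞} (hf : Measurable f) :
    ∫⁻ x, f x = ∫⁻ t : ℝ, ∫⁻ y : Fin n → ℝ, f (Fin.cons t y) := by
  have e := (volume_preserving_piFinSuccAbove (fun _ : Fin (n + 1) => ℝ) 0).symm
  rw [← e.lintegral_comp hf, Measure.volume_eq_prod, lintegral_prod]
  · simp [MeasurableEquiv.piFinSuccAbove, Fin.insertNthEquiv]
  · exact (hf.comp (MeasurableEquiv.measurable _)).aemeasurable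

theorem prekopa_leindler_pi {p q : ℝ} (hp : 0 < p) (hq : 0 < q) (hpq : p + q = 1) (n : ℕ)
    {f g h : (Fin n → ℝ) → ℝ≥0∞} (hf : Measurable f) (hg : Measurable g) (hh : Measurable h)
    (hfg : ∀ x y, f x ^ p * g y ^ q ≤ h (p • x + q • y)) :
    (∫⁻ x, f x) ^ p * (∫⁻ x, g x) ^ q ≤ ∫⁻ x, h x := by
  induction n with
  | zero =>
    simp only [Measure.volume_pi_eq_dirac (0 : Fin 0 → ℝ), lintegral_dirac]
    simpa using hfg 0 0
  | succ n ih =>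
    rw [lintegral_fin_succ hf, lintegral_fin_succ hg, lintegral_fin_succ hh]
    have hcons : Measurable fun z : ℝ × (Fin n → ℝ) => (Fin.cons z.1 z.2 : Fin (n + 1) → ℝ) := by
      refine measurable_pi_iff.mpr fun i => ?_
      refine Fin.cases ?_ (fun j => ?_) i
      · simpa using measurable_fst
      · simpa [Function.comp_def] using (measurable_pi_apply j).comp measurable_snd
    have hm : ∀ {f : (Fin (n + 1) → ℝ) → ℝ≥0∞}, Measurable f →
        Measurable fun t : ℝ => ∫⁻ y : Fin n → ℝ, f (Fin.cons t y) := fun hf =>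
      (hf.comp hcons).lintegral_prod_right'
    have hs : ∀ {f : (Fin (n + 1) → ℝ) → ℝ≥0∞}, Measurable f → ∀ t : ℝ,
        Measurable fun y : Fin n → ℝ => f (Fin.cons t y) := fun hf t =>
      hf.comp (hcons.comp measurable_prodMk_left)
    refine prekopa_leindler_real hp hq hpq (hm hf) (hm hg) (hm hh) fun s t => ?_
    refine ih (hs hf s) (hs hg t) (hs hh _) fun x y => ?_
    convert hfg (Fin.cons s x) (Fin.cons t y) using 2
    ext i
    refine Fin.cases ?_ (fun j => ?_) i <;> simp

theorem prekopa_leindler_euc {p q : ℝ} (hp : 0 < p) (hq : 0 < q) (hpq : p + q = 1) (n : ℕ)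
    {f g h : Euc n → ℝ≥0∞} (hf : Measurable f) (hg : Measurable g) (hh : Measurable h)
    (hfg : ∀ x y, f x ^ p * g y ^ q ≤ h (p • x + q • y)) :
    (∫⁻ x, f x) ^ p * (∫⁻ x, g x) ^ q ≤ ∫⁻ x, h x := by
  have e := PiLp.volume_preserving_toLp (Fin n)
  rw [← e.lintegral_comp hf, ← e.lintegral_comp hg, ← e.lintegral_comp hh]
  refine prekopa_leindler_pi hp hq hpq n (hf.comp e.measurable) (hg.comp e.measurable)
    (hh.comp e.measurable) fun x y => ?_
  simpa using hfg (WithLp.toLp 2 x) (WithLp.toLp 2 y)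

theorem lintegral_indicator_preimage_smul {n : ℕ} {A : Set (Euc n)} (hA : MeasurableSet A)
    {c : ℝ} (hc : 0 < c) :
    ∫⁻ x, ((fun x : Euc n => c • x) ⁻¹' A).indicator 1 x =
      ENNReal.ofReal ((c ^ n)⁻¹) * volume A := by
  have hm : MeasurableSet ((fun x : Euc n => c • x) ⁻¹' A) := hA.preimage (measurable_const_smul c)
  rw [lintegral_indicator_one hm, Measure.addHaar_preimage_smul _ hc.ne']
  simp [abs_of_pos (pow_pos hc n)]

/-- The Brunn–Minkowski inequality when one of the sets is a ball. -/
theorem add_pow_le_volume_thickening {n : ℕ} {A : Set (Euc n)} (hA : MeasurableSet A)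
    {α β r : ℝ} (hα : 0 < α) (hβ : 0 < β) (hAα : volume A = ENNReal.ofReal (α ^ n))
    (hBβ : volume (Metric.ball (0 : Euc n) r) = ENNReal.ofReal (β ^ n)) :
    ENNReal.ofReal ((α + β) ^ n) ≤ volume (Metric.thickening r A) := by
  have hαβ : 0 < α + β := add_pos hα hβ
  set p := α / (α + β) with hp
  set q := β / (α + β) with hq
  have hpq : p + q = 1 := by rw [hp, hq, ← add_div, div_self hαβ.ne']
  have hp0 : 0 < p := div_pos hα hαβ
  have hq0 : 0 < q := div_pos hβ hαβ
  have hB : MeasurableSet (Metric.ball (0 : Euc n) r) := measurableSet_ball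
  have hT : MeasurableSet (Metric.thickening r A) := Metric.isOpen_thickening.measurableSet
  have key := prekopa_leindler_euc hp0 hq0 hpq n
    (f := ((fun x : Euc n => α • x) ⁻¹' A).indicator 1)
    (g := ((fun x : Euc n => β • x) ⁻¹' (Metric.ball 0 r)).indicator 1)
    (h := ((fun x : Euc n => (α + β) • x) ⁻¹' (Metric.thickening r A)).indicator 1)
    (measurable_one.indicator (hA.preimage (measurable_const_smul α)))
    (measurable_one.indicator (hB.preimage (measurable_const_smul β)))
    (measurable_one.indicator (hT.preimage (measurable_const_smul _))) ?_
  · rw [lintegral_indicator_preimage_smul hA hα, lintegral_indicator_preimage_smul hB hβ,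
      lintegral_indicator_preimage_smul hT hαβ, hAα, hBβ, ← ENNReal.ofReal_mul (by positivity),
      ← ENNReal.ofReal_mul (by positivity), inv_mul_cancel₀ (by positivity),
      inv_mul_cancel₀ (by positivity), ENNReal.ofReal_one, ENNReal.one_rpow, ENNReal.one_rpow,
      one_mul] at key
    calc ENNReal.ofReal ((α + β) ^ n) = ENNReal.ofReal ((α + β) ^ n) * 1 := (mul_one _).symm
      _ ≤ ENNReal.ofReal ((α + β) ^ n) *
          (ENNReal.ofReal (((α + β) ^ n)⁻¹) * volume (Metric.thickening r A)) := by gcongr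
      _ = volume (Metric.thickening r A) := by
        rw [← mul_assoc, ← ENNReal.ofReal_mul (by positivity), mul_inv_cancel₀ (by positivity)]
        simp
  · intro x y
    by_cases hx : α • x ∈ A
    · by_cases hy : β • y ∈ Metric.ball (0 : Euc n) r
      · have : (α + β) • (p • x + q • y) ∈ Metric.thickening r A := by
          have h1 : (α + β) • (p • x + q • y) = α • x + β • y := by
            rw [smul_add, smul_smul, smul_smul, hp, hq, mul_div_cancel₀ _ hαβ.ne',
              mul_div_cancel₀ _ hαβ.ne']
          rw [h1, Metric.mem_thickening_iff]
          exact ⟨_, hx, by simpa using hy⟩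
        have e1 : ∀ (c : ℝ) (S : Set (Euc n)) (z : Euc n), c • z ∈ S →
            ((fun x : Euc n => c • x) ⁻¹' S).indicator (1 : Euc n → ℝ≥0∞) z = 1 :=
          fun c S z hz => Set.indicator_of_mem (s := (fun x : Euc n => c • x) ⁻¹' S) hz _
        rw [e1 _ _ _ hx, e1 _ _ _ hy, e1 _ _ _ this]
        simp
      · have : ((fun x : Euc n => β • x) ⁻¹' (Metric.ball 0 r)).indicator (1 : Euc n → ℝ≥0∞) y =
            0 :=
          Set.indicator_of_notMem (s := (fun x : Euc n => β • x) ⁻¹' (Metric.ball 0 r)) hy _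
        simp [this, hq0]
    · have : ((fun x : Euc n => α • x) ⁻¹' A).indicator (1 : Euc n → ℝ≥0∞) x = 0 :=
        Set.indicator_of_notMem (s := (fun x : Euc n => α • x) ⁻¹' A) hx _
      simp [this, hp0]

theorem pow_add_le_add_pow {α β : ℝ} (hα : 0 ≤ α) (hβ : 0 ≤ β) {n : ℕ} (hn : 1 ≤ n) :
    α ^ n + n * α ^ (n - 1) * β ≤ (α + β) ^ n := by
  induction n, hn using Nat.le_induction with
  | base => simp
  | succ n hn ih =>
    obtain ⟨k, rfl⟩ : ∃ k, n = k + 1 := ⟨n - 1, by omega⟩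
    simp only [Nat.add_sub_cancel] at ih ⊢
    calc _ ≤ (α ^ (k + 1) + (k + 1 : ℕ) * α ^ k * β) * (α + β) := by
          push_cast
          have : 0 ≤ ((k : ℝ) + 1) * α ^ k * β ^ 2 := by positivity
          ring_nf at this ⊢
          linarith
      _ ≤ (α + β) ^ (k + 1) * (α + β) := by gcongr
      _ = _ := by ring

/-- The isoperimetric constant `n |B₁|^{1/n}` of `ℝⁿ`. -/
def isoConst (n : ℕ) : ℝ :=
  n * (volume (Metric.ball (0 : Euc n) 1)).toReal ^ (1 / (n : ℝ))

theorem volume_add_le_volume_thickening {n : ℕ} (hn : 2 ≤ n) {A : Set (Euc n)}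
    (hA : MeasurableSet A) (hAT : volume A ≠ ⊤) {r : ℝ} (hr : 0 < r) :
    volume A + ENNReal.ofReal (isoConst n * (volume A).toReal ^ (1 - 1 / (n : ℝ)) * r) ≤
      volume (Metric.thickening r A) := by
  have hn1 : (1 : ℝ) < n := by exact_mod_cast hn
  have hn0 : (n : ℝ) ≠ 0 := by positivity
  rcases eq_or_ne (volume A) 0 with h0 | h0
  · have : (1 : ℝ) - (n : ℝ)⁻¹ ≠ 0 := by
      rw [sub_ne_zero]
      exact (inv_lt_one_of_one_lt₀ hn1).ne'
    simp [h0, Real.zero_rpow this]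
  have : Nonempty (Fin n) := ⟨⟨0, by omega⟩⟩
  set a := (volume A).toReal with ha
  set κ := (volume (Metric.ball (0 : Euc n) 1)).toReal with hκ
  have ha0 : 0 < a := ENNReal.toReal_pos h0 hAT
  have hκT : volume (Metric.ball (0 : Euc n) 1) ≠ ⊤ := measure_ball_lt_top.ne
  have hκ0 : 0 < κ := ENNReal.toReal_pos (Metric.measure_ball_pos _ _ one_pos).ne' hκT
  have hpow : ∀ x : ℝ, 0 < x → (x ^ (1 / (n : ℝ))) ^ n = x := fun x hx => by
    rw [← Real.rpow_natCast, ← Real.rpow_mul hx.le, one_div_mul_cancel hn0, Real.rpow_one]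
  have key := add_pow_le_volume_thickening hA (α := a ^ (1 / (n : ℝ)))
    (β := κ ^ (1 / (n : ℝ)) * r) (r := r) (by positivity) (by positivity)
    (by rw [hpow a ha0, ha, ENNReal.ofReal_toReal hAT])
    (by rw [mul_pow, hpow κ hκ0, Measure.addHaar_ball _ _ hr.le, finrank_euclideanSpace_fin,
          mul_comm κ, ENNReal.ofReal_mul (by positivity), hκ, ENNReal.ofReal_toReal hκT])
  refine le_trans ?_ key
  rw [← ENNReal.ofReal_toReal hAT, ← ha, ← ENNReal.ofReal_add ha0.le
    (by unfold isoConst; positivity)]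
  apply ENNReal.ofReal_le_ofReal
  refine le_trans (le_of_eq ?_) (pow_add_le_add_pow (by positivity) (by positivity)
    (n := n) (by omega))
  rw [hpow a ha0, isoConst, ← hκ]
  have : (a ^ (1 / (n : ℝ))) ^ (n - 1) = a ^ (1 - 1 / (n : ℝ)) := by
    rw [← Real.rpow_natCast, ← Real.rpow_mul ha0.le, Nat.cast_sub (by omega)]
    congr 1
    field_simp
    simp
  rw [this]
  ring

theorem exists_sub_le_mul_norm_fderiv_add {n : ℕ} {g : Euc n → ℝ} (hg : ContDiff ℝ 1 g)
    (hgs : HasCompactSupport g) {ε : ℝ} (hε : 0 < ε) :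
    ∃ r, 0 < r ∧ r ≤ 1 ∧ ∀ x y, dist y x < r → g y - g x ≤ r * (‖fderiv ℝ g x‖ + ε) := by
  have hc : Continuous (fderiv ℝ g) := hg.continuous_fderiv one_ne_zero
  have hu : UniformContinuous (fderiv ℝ g) :=
    (hgs.fderiv (𝕜 := ℝ)).uniformContinuous_of_continuous hc
  obtain ⟨δ, hδ, hδε⟩ := Metric.uniformContinuous_iff.mp hu ε hε
  refine ⟨min δ 1, lt_min hδ one_pos, min_le_right _ _, fun x y hxy => ?_⟩
  have h1 : ∀ z ∈ Metric.ball x (min δ 1), ‖fderiv ℝ g z‖ ≤ ‖fderiv ℝ g x‖ + ε := by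
    intro z hz
    have := hδε ((Metric.mem_ball.mp hz).trans_le (min_le_left _ _))
    rw [dist_eq_norm] at this
    have h2 := norm_sub_norm_le (fderiv ℝ g z) (fderiv ℝ g x)
    linarith
  have h2 := (convex_ball x (min δ 1)).norm_image_sub_le_of_norm_fderiv_le
    (fun z _ => hg.differentiable one_ne_zero z) h1
    (Metric.mem_ball_self (lt_min hδ one_pos)) (Metric.mem_ball.mpr hxy)
  rw [← dist_eq_norm y x] at h2
  have h3 : (‖fderiv ℝ g x‖ + ε) * dist y x ≤ (‖fderiv ℝ g x‖ + ε) * min δ 1 := by gcongr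
  have h4 := le_abs_self (g y - g x)
  rw [Real.norm_eq_abs] at h2
  linarith

theorem isoConst_mul_le_integral_norm_fderiv {n : ℕ} (hn : 2 ≤ n) {g : Euc n → ℝ}
    (hg : ContDiff ℝ 1 g) (hgs : HasCompactSupport g) (h0 : ∀ x, 0 ≤ g x) (h1 : ∀ x, g x ≤ 1)
    {S : Set (Euc n)} (hS : ∀ x ∈ S, 1 ≤ g x) :
    isoConst n * (volume S).toReal ^ (1 - 1 / (n : ℝ)) ≤ ∫ x, ‖fderiv ℝ g x‖ := by
  have hn1 : (1 : ℝ) ≤ n := by exact_mod_cast (by omega : 1 ≤ n)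
  have hexp : (0 : ℝ) ≤ 1 - 1 / (n : ℝ) := by
    have : 1 / (n : ℝ) ≤ 1 := by rw [div_le_one] <;> linarith
    linarith
  have hC : 0 ≤ isoConst n := by unfold isoConst; positivity
  set D := isoConst n * (volume S).toReal ^ (1 - 1 / (n : ℝ)) with hD
  have hD0 : 0 ≤ D := by positivity
  have hgc : Continuous g := hg.continuous
  have hgi : Integrable g := hgc.integrable_of_hasCompactSupport hgs
  have hdc : Continuous fun x => ‖fderiv ℝ g x‖ := (hg.continuous_fderiv one_ne_zero).norm
  have hdi : Integrable fun x => ‖fderiv ℝ g x‖ :=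
    hdc.integrable_of_hasCompactSupport (hgs.fderiv (𝕜 := ℝ)).norm
  set K := Metric.cthickening 1 (tsupport g) with hK
  have hKc : IsCompact K := hgs.isCompact.cthickening
  have hKT : volume K ≠ ⊤ := hKc.measure_lt_top.ne
  have hlevel : ∀ τ : ℝ, 0 < τ → volume {x | τ < g x} ≠ ⊤ := fun τ hτ => by
    refine ne_top_of_le_ne_top (hgs.isCompact.measure_lt_top (μ := volume)).ne (measure_mono ?_)
    intro x hx
    exact subset_tsupport g (Function.mem_support.mpr (hτ.trans hx).ne')
  have main : ∀ ε > 0, D ≤ (∫ x, ‖fderiv ℝ g x‖) + ε * volume.real K := by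
    intro ε hε
    obtain ⟨r, hr0, hr1, hr⟩ := exists_sub_le_mul_norm_fderiv_add hg hgs hε
    set G : Euc n → ℝ := fun x => g x + r * (‖fderiv ℝ g x‖ + ε * K.indicator 1 x) with hG
    have hKi : Integrable (K.indicator (1 : Euc n → ℝ)) :=
      (integrable_indicator_iff hKc.isClosed.measurableSet).mpr
          (integrableOn_const (C := (1 : ℝ)) hKT)
    have hEi : Integrable fun x => r * (‖fderiv ℝ g x‖ + ε * K.indicator 1 x) :=
      (hdi.add (hKi.const_mul ε)).const_mul r
    have hGi : Integrable G := hgi.add hEi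
    have hind : ∀ x, 0 ≤ K.indicator (1 : Euc n → ℝ) x := fun x =>
      Set.indicator_nonneg (fun _ _ => zero_le_one) x
    have hG0 : ∀ x, 0 ≤ G x := fun x => by
      have := h0 x
      have := hind x
      positivity
    have hGint : ∫ x, G x = (∫ x, g x) + r * ((∫ x, ‖fderiv ℝ g x‖) + ε * volume.real K) := by
      simp only [hG]
      rw [integral_add hgi hEi, integral_const_mul,
        integral_add hdi (hKi.const_mul ε), integral_const_mul,
        integral_indicator_one hKc.isClosed.measurableSet]
    have hsub : ∀ τ : ℝ, 0 < τ → Metric.thickening r {x | τ < g x} ⊆ {x | τ < G x} := by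
      intro τ hτ x hx
      obtain ⟨y, hy, hxy⟩ := Metric.mem_thickening_iff.mp hx
      have hyS : y ∈ tsupport g :=
        subset_tsupport g (Function.mem_support.mpr (hτ.trans hy).ne')
      have hxK : x ∈ K := Metric.mem_cthickening_of_dist_le x y 1 _ hyS (hxy.le.trans hr1)
      have h2 := hr x y (by rwa [dist_comm])
      have hy' : τ < g y := hy
      change τ < g x + r * (‖fderiv ℝ g x‖ + ε * K.indicator 1 x)
      rw [Set.indicator_of_mem hxK]
      simp only [Pi.one_apply, mul_one]
      linarith
    have hlow : (∫⁻ x, ENNReal.ofReal (g x)) + ENNReal.ofReal (D * r) ≤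
        ∫⁻ x, ENNReal.ofReal (G x) := by
      rw [lintegral_eq_lintegral_Ioo_meas_lt hgc.measurable h0 h1,
        lintegral_eq_lintegral_meas_lt _ (Eventually.of_forall hG0) hGi.aemeasurable]
      have hconst : ENNReal.ofReal (D * r) =
          ∫⁻ τ in Set.Ioo (0 : ℝ) 1, ENNReal.ofReal (D * r) := by simp
      rw [hconst, ← lintegral_add_right _ measurable_const]
      refine le_trans ?_ (lintegral_mono_set (s := Set.Ioo 0 1) Set.Ioo_subset_Ioi_self)
      refine setLIntegral_mono' measurableSet_Ioo ?_
      rintro τ ⟨hτ0, hτ1⟩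
      refine le_trans ?_ ((volume_add_le_volume_thickening hn
        (measurableSet_lt measurable_const hgc.measurable) (hlevel τ hτ0) hr0).trans
        (measure_mono (hsub τ hτ0)))
      have hSle : (volume S).toReal ≤ (volume {x | τ < g x}).toReal :=
        ENNReal.toReal_mono (hlevel τ hτ0)
          (measure_mono fun x hx => lt_of_lt_of_le hτ1 (hS x hx))
      have hDle : D ≤ isoConst n * (volume {x | τ < g x}).toReal ^ (1 - 1 / (n : ℝ)) := by
        rw [hD]
        gcongr
      gcongr
    rw [← ofReal_integral_eq_lintegral_ofReal hgi (Eventually.of_forall h0),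
      ← ofReal_integral_eq_lintegral_ofReal hGi (Eventually.of_forall hG0),
      ← ENNReal.ofReal_add (integral_nonneg h0) (by positivity),
      ENNReal.ofReal_le_ofReal_iff (integral_nonneg hG0), hGint] at hlow
    have : r * D ≤ r * ((∫ x, ‖fderiv ℝ g x‖) + ε * volume.real K) := by linarith
    exact le_of_mul_le_mul_left this hr0
  refine le_of_forall_pos_le_add fun ε hε => ?_
  have hV : 0 ≤ volume.real K := measureReal_nonneg
  refine (main (ε / (volume.real K + 1)) (by positivity)).trans ?_
  gcongr
  rw [div_mul_eq_mul_div, div_le_iff₀ (by positivity)]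
  nlinarith

theorem lapl_eq_sum_fderiv {n : ℕ} {u : Euc n → ℝ} (hu : ContDiff ℝ 2 u) (x : Euc n) :
    lapl n u x = ∑ i : Fin n, fderiv ℝ (fun y => fderiv ℝ u y (EuclideanSpace.single i 1)) x
      (EuclideanSpace.single i 1) := by
  unfold lapl
  refine Finset.sum_congr rfl fun i _ => ?_
  rw [iteratedFDeriv_two_apply, fderiv_clm_apply]
  · simp
  · exact ((hu.fderiv_right (m := 1) (by norm_num)).differentiable one_ne_zero) x
  · exact differentiableAt_const _

theorem norm_sq_eq_sum_apply_single {n : ℕ} (L : Euc n →L[ℝ] ℝ) :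
    ‖L‖ ^ 2 = ∑ i : Fin n, L (EuclideanSpace.single i 1) ^ 2 := by
  obtain ⟨v, rfl⟩ := (InnerProductSpace.toDual ℝ (Euc n)).surjective L
  rw [LinearIsometryEquiv.norm_map, EuclideanSpace.norm_sq_eq]
  refine Finset.sum_congr rfl fun i _ => ?_
  simp [EuclideanSpace.inner_single_right]

/-- Integration by parts against a `C¹` function without assumptions on its support. -/
theorem integral_lapl_mul {n : ℕ} {u v : Euc n → ℝ} (hu : ContDiff ℝ 2 u)
    (hus : HasCompactSupport u) (hv : ContDiff ℝ 1 v) :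
    Integrable (fun x => v x * lapl n u x) ∧
    ∫ x, v x * lapl n u x = - ∫ x, ∑ i : Fin n,
      fderiv ℝ v x (EuclideanSpace.single i 1) * fderiv ℝ u x (EuclideanSpace.single i 1) := by
  simp only [lapl_eq_sum_fderiv hu, Finset.mul_sum]
  set e : Fin n → Euc n := fun i => EuclideanSpace.single i 1 with he
  have hw : ∀ i, ContDiff ℝ 1 fun y => fderiv ℝ u y (e i) := fun i =>
    (hu.fderiv_right (m := 1) (by norm_num)).clm_apply contDiff_const
  have hws : ∀ i, HasCompactSupport fun y => fderiv ℝ u y (e i) := fun i =>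
    hus.fderiv_apply (𝕜 := ℝ) (e i)
  have hv' : ∀ i, Continuous fun x => fderiv ℝ v x (e i) := fun i =>
    (hv.continuous_fderiv one_ne_zero).clm_apply continuous_const
  have hw' : ∀ i, Continuous fun x => fderiv ℝ (fun y => fderiv ℝ u y (e i)) x (e i) := fun i =>
    ((hw i).continuous_fderiv one_ne_zero).clm_apply continuous_const
  have i1 : ∀ i, Integrable fun x => fderiv ℝ v x (e i) * fderiv ℝ u x (e i) := fun i =>
    ((hv' i).mul (hw i).continuous).integrable_of_hasCompactSupport (hws i).mul_left
  have i2 : ∀ i, Integrable fun x => v x * fderiv ℝ (fun y => fderiv ℝ u y (e i)) x (e i) :=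
    fun i => (hv.continuous.mul (hw' i)).integrable_of_hasCompactSupport
      ((hws i).fderiv_apply (𝕜 := ℝ) (e i)).mul_left
  have i3 : ∀ i, Integrable fun x => v x * fderiv ℝ u x (e i) := fun i =>
    (hv.continuous.mul (hw i).continuous).integrable_of_hasCompactSupport (hws i).mul_left
  refine ⟨integrable_finsetSum _ fun i _ => i2 i, ?_⟩
  rw [integral_finsetSum _ fun i _ => i2 i, integral_finsetSum _ fun i _ => i1 i,
    ← Finset.sum_neg_distrib]
  refine Finset.sum_congr rfl fun i _ => ?_
  exact integral_mul_fderiv_eq_neg_fderiv_mul_of_integrable (i1 i) (i2 i) (i3 i)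
    (fun x _ => hv.differentiable one_ne_zero x) (fun x _ => (hw i).differentiable one_ne_zero x)

theorem continuous_lapl {n : ℕ} {u : Euc n → ℝ} (hu : ContDiff ℝ 2 u) :
    Continuous (lapl n u) := by
  rw [funext (lapl_eq_sum_fderiv hu)]
  refine continuous_finsetSum _ fun i _ => ?_
  have : ContDiff ℝ 1 fun y => fderiv ℝ u y (EuclideanSpace.single i 1) :=
    (hu.fderiv_right (m := 1) (by norm_num)).clm_apply contDiff_const
  exact (this.continuous_fderiv one_ne_zero).clm_apply continuous_const

theorem tsupport_lapl_subset {n : ℕ} {u : Euc n → ℝ} (hu : ContDiff ℝ 2 u) :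
    tsupport (lapl n u) ⊆ tsupport u := by
  rw [funext (lapl_eq_sum_fderiv hu)]
  refine closure_minimal (fun x hx => ?_) (isClosed_tsupport u)
  obtain ⟨i, -, hi⟩ := Finset.exists_ne_zero_of_sum_ne_zero hx
  exact tsupport_fderiv_apply_subset ℝ _ (tsupport_fderiv_apply_subset ℝ _
    (subset_tsupport _ (Function.mem_support.mpr hi)))

theorem integrable_lapl {n : ℕ} {u : Euc n → ℝ} (hu : ContDiff ℝ 2 u)
    (hus : HasCompactSupport u) : Integrable (lapl n u) :=
  (continuous_lapl hu).integrable_of_hasCompactSupport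
    (hus.of_isClosed_subset (isClosed_tsupport _) (tsupport_lapl_subset hu))

theorem integral_lapl_eq_zero {n : ℕ} {u : Euc n → ℝ} (hu : ContDiff ℝ 2 u)
    (hus : HasCompactSupport u) : ∫ x, lapl n u x = 0 := by
  simpa using (integral_lapl_mul hu hus (v := fun _ => 1) contDiff_const).2

/-- Since `∫ Δu = 0`, only half of the mass of `Δu` is seen by a function with values in
`[0, H]`. -/
theorem neg_integral_mul_lapl_le {n : ℕ} {u v : Euc n → ℝ} (hu : ContDiff ℝ 2 u)
    (hus : HasCompactSupport u) (hv : ContDiff ℝ 1 v) {H : ℝ} (hv0 : ∀ x, 0 ≤ v x)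
    (hvH : ∀ x, v x ≤ H) :
    - ∫ x, v x * lapl n u x ≤ H * ((∫ x, |lapl n u x|) / 2) := by
  have hi := integrable_lapl hu hus
  have h1 : H * ((∫ x, |lapl n u x|) / 2) = ∫ x, H * ((|lapl n u x| - lapl n u x) / 2) := by
    rw [integral_const_mul, integral_div, integral_sub hi.abs hi, integral_lapl_eq_zero hu hus,
      sub_zero]
  rw [h1, ← integral_neg]
  refine integral_mono (integral_lapl_mul hu hus hv).1.neg
    (((hi.abs.sub hi).div_const 2).const_mul H) fun x => ?_
  have h0 := hv0 x
  have hH := hvH x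
  simp only
  rcases le_total 0 (lapl n u x) with h | h
  · rw [abs_of_nonneg h]
    nlinarith
  · rw [abs_of_nonpos h]
    nlinarith

/-- A smoothed truncation between the levels `s` and `s + h`. -/
theorem exists_smooth_truncation (s : ℝ) {h δ : ℝ} (hδ : 0 < δ) (hδh : 2 * δ < h) :
    ∃ k η : ℝ → ℝ, Continuous k ∧ (∀ τ, HasDerivAt η (k τ) τ) ∧ (∀ τ, 0 ≤ k τ) ∧ (∀ τ, k τ ≤ 1) ∧
      (∀ τ ≤ s, k τ = 0) ∧ (∀ τ, s + h ≤ τ → k τ = 0) ∧ (∀ τ ≤ s, η τ = 0) ∧ (∀ τ, 0 ≤ η τ) ∧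
      ∃ H, h - 2 * δ ≤ H ∧ (∀ τ, η τ ≤ H) ∧ (∀ τ, s + h ≤ τ → η τ = H) := by
  obtain ⟨k, hk0, hk1, hk⟩ := exists_continuous_zero_one_of_isClosed
    (s := (Set.Ioo s (s + h))ᶜ) (t := Set.Icc (s + δ) (s + h - δ)) isOpen_Ioo.isClosed_compl
    isClosed_Icc (by
      rw [Set.disjoint_left]
      rintro x hx ⟨h1, h2⟩
      exact hx ⟨by linarith, by linarith⟩)
  have hkl : ∀ τ ≤ s, k τ = 0 := fun τ hτ => hk0 fun h => absurd h.1 (not_lt.mpr hτ)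
  have hkr : ∀ τ, s + h ≤ τ → k τ = 0 := fun τ hτ => hk0 fun h => absurd h.2 (not_lt.mpr hτ)
  have hii : ∀ a b, IntervalIntegrable k volume a b := fun a b =>
      k.continuous.intervalIntegrable a b
  have hmono : Monotone fun τ => ∫ x in s..τ, k x := by
    intro a b hab
    simp only
    rw [← intervalIntegral.integral_add_adjacent_intervals (hii s a) (hii a b)]
    have := intervalIntegral.integral_nonneg (μ := volume) hab (fun x _ => (hk x).1)
    linarith
  have hl : ∀ τ ≤ s, ∫ x in s..τ, k x = 0 := fun τ hτ => by
    rw [intervalIntegral.integral_symm, intervalIntegral.integral_congr (g := fun _ => 0)]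
    · simp
    · intro x hx
      rw [Set.uIcc_of_le hτ] at hx
      exact hkl x hx.2
  have hr : ∀ τ, s + h ≤ τ → ∫ x in s..τ, k x = ∫ x in s..(s + h), k x := fun τ hτ => by
    rw [← intervalIntegral.integral_add_adjacent_intervals (hii s (s + h)) (hii (s + h) τ),
      intervalIntegral.integral_congr (a := s + h) (g := fun _ => 0)]
    · simp
    · intro x hx
      rw [Set.uIcc_of_le hτ] at hx
      exact hkr x hx.1
  refine ⟨k, fun τ => ∫ x in s..τ, k x, k.continuous, fun τ =>
    k.continuous.integral_hasStrictDerivAt s τ |>.hasDerivAt, fun τ => (hk τ).1, fun τ => (hk τ).2,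
    hkl, hkr, hl, fun τ => ?_, ∫ x in s..(s + h), k x, ?_, fun τ => ?_, hr⟩
  · rcases le_total τ s with h1 | h1
    · exact (hl τ h1).ge
    · exact intervalIntegral.integral_nonneg h1 fun x _ => (hk x).1
  · rw [← intervalIntegral.integral_add_adjacent_intervals (hii s (s + δ)) (hii (s + δ) (s + h)),
      ← intervalIntegral.integral_add_adjacent_intervals (hii (s + δ) (s + h - δ))
        (hii (s + h - δ) (s + h))]
    have h1 := intervalIntegral.integral_nonneg (a := s) (b := s + δ) (μ := volume) (by linarith)
      (fun x _ => (hk x).1)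
    have h2 := intervalIntegral.integral_nonneg (a := s + h - δ) (b := s + h) (μ := volume)
      (by linarith) (fun x _ => (hk x).1)
    have h3 : ∫ x in (s + δ)..(s + h - δ), k x = h - 2 * δ := by
      rw [intervalIntegral.integral_congr (g := fun _ => 1)]
      · simp
        ring
      · intro x hx
        rw [Set.uIcc_of_le (by linarith)] at hx
        exact hk1 hx
    linarith
  · rcases le_total τ (s + h) with h1 | h1
    · exact hmono h1
    · exact (hr τ h1).le

theorem sq_integral_mul_le {α : Type*} [MeasurableSpace α] {μ : Measure α} {w f : α → ℝ}
    (hw : ∀ x, 0 ≤ w x) (h0 : Integrable w μ) (h1 : Integrable (fun x => w x * f x) μ)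
    (h2 : Integrable (fun x => w x * f x ^ 2) μ) :
    (∫ x, w x * f x ∂μ) ^ 2 ≤ (∫ x, w x * f x ^ 2 ∂μ) * ∫ x, w x ∂μ := by
  have key : ∀ t : ℝ, 0 ≤ (∫ x, w x ∂μ) * (t * t) + (-2 * ∫ x, w x * f x ∂μ) * t +
      ∫ x, w x * f x ^ 2 ∂μ := by
    intro t
    have h01 : Integrable (fun x => w x * (t * t) + w x * f x * (-2 * t)) μ :=
      (h0.mul_const _).add (h1.mul_const _)
    have : (∫ x, w x ∂μ) * (t * t) + (-2 * ∫ x, w x * f x ∂μ) * t + ∫ x, w x * f x ^ 2 ∂μ =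
        ∫ x, (w x * (t * t) + w x * f x * (-2 * t)) + w x * f x ^ 2 ∂μ := by
      rw [integral_add h01 h2,
        integral_add (h0.mul_const _) (h1.mul_const _), integral_mul_const, integral_mul_const]
      ring
    rw [this]
    refine integral_nonneg fun x => ?_
    have := mul_nonneg (hw x) (sq_nonneg (t - f x))
    simp only [Pi.zero_apply]
    linarith
  have := discrim_le_zero key
  rw [discrim] at this
  nlinarith

theorem measurableSet_superlevel {n : ℕ} {u : Euc n → ℝ} (hu : Continuous u) (s : ℝ) :
    MeasurableSet {x | s < u x} :=
  measurableSet_lt measurable_const hu.measurable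

theorem volume_superlevel_ne_top {n : ℕ} {u : Euc n → ℝ} (hus : HasCompactSupport u) {s : ℝ}
    (hs : 0 ≤ s) : volume {x | s < u x} ≠ ⊤ := by
  refine ne_top_of_le_ne_top (hus.isCompact.measure_lt_top (μ := volume)).ne (measure_mono ?_)
  intro x hx
  exact subset_tsupport u (Function.mem_support.mpr (hs.trans_lt hx).ne')

theorem volume_superlevel_sub_ge {n : ℕ} (hn : 2 ≤ n) {u : Euc n → ℝ} (hu : ContDiff ℝ 2 u)
    (hus : HasCompactSupport u) {F : ℝ} (hF : ∫ x, |lapl n u x| ≤ F) {s h : ℝ} (hs : 0 ≤ s)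
    (hh : 0 < h) :
    h * isoConst n ^ 2 * volume.real {x | s + h < u x} ^ (2 - 2 / (n : ℝ)) ≤
      F / 2 * (volume.real {x | s < u x} - volume.real {x | s + h < u x}) := by
  set A := volume.real {x | s < u x} with hA
  set B := volume.real {x | s + h < u x} with hB
  set c := isoConst n with hc
  have hc0 : 0 ≤ c := by rw [hc, isoConst]; positivity
  have hB0 : 0 ≤ B := measureReal_nonneg
  have hu1 : ContDiff ℝ 1 u := hu.of_le (by norm_num)
  have hF0 : 0 ≤ F := (integral_nonneg fun x => abs_nonneg _).trans hF
  have main : ∀ δ : ℝ, 0 < δ → 2 * δ < h →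
      (h - 2 * δ) * (c * B ^ (1 - 1 / (n : ℝ))) ^ 2 ≤ F / 2 * (A - B) := by
    intro δ hδ hδh
    obtain ⟨k, η, hk, hη, hk0, hk1, hkl, hkr, hηl, hη0, H, hH, hηH, hηr⟩ :=
      exists_smooth_truncation s hδ hδh
    have hHpos : 0 < H := by linarith
    have hηc : ContDiff ℝ 1 η := by
      rw [contDiff_one_iff_deriv]
      refine ⟨fun τ => (hη τ).differentiableAt, ?_⟩
      rw [funext fun τ => (hη τ).deriv]
      exact hk
    set v : Euc n → ℝ := fun x => η (u x) with hv
    have hv1 : ContDiff ℝ 1 v := hηc.comp hu1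
    have hvs : HasCompactSupport v := hus.comp_left (g := η) (hηl 0 hs)
    have hvd : ∀ x, fderiv ℝ v x = k (u x) • fderiv ℝ u x := fun x =>
      ((hη (u x)).comp_hasFDerivAt x (hu1.differentiable one_ne_zero x).hasFDerivAt).fderiv
    have hkc : Continuous fun x => k (u x) := hk.comp hu.continuous
    have hks : HasCompactSupport fun x => k (u x) := hus.comp_left (g := k) (hkl 0 hs)
    have hdc : Continuous fun x => ‖fderiv ℝ u x‖ := (hu1.continuous_fderiv one_ne_zero).norm
    have i0 : Integrable fun x => k (u x) := hkc.integrable_of_hasCompactSupport hks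
    have i1 : Integrable fun x => k (u x) * ‖fderiv ℝ u x‖ :=
      (hkc.mul hdc).integrable_of_hasCompactSupport hks.mul_right
    have i2 : Integrable fun x => k (u x) * ‖fderiv ℝ u x‖ ^ 2 :=
      (hkc.mul (hdc.pow 2)).integrable_of_hasCompactSupport hks.mul_right
    have iso : c * B ^ (1 - 1 / (n : ℝ)) ≤ H⁻¹ * ∫ x, k (u x) * ‖fderiv ℝ u x‖ := by
      have := isoConst_mul_le_integral_norm_fderiv hn (g := fun x => H⁻¹ * v x)
        (contDiff_const.mul hv1) hvs.mul_left (fun x => ?_) (fun x => ?_)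
        (S := {x | s + h < u x}) (fun x hx => ?_)
      · refine this.trans (le_of_eq ?_)
        rw [← integral_const_mul]
        congr 1
        ext x
        have : fderiv ℝ (fun x => H⁻¹ * v x) x = H⁻¹ • fderiv ℝ v x :=
          fderiv_const_mul (hv1.differentiable one_ne_zero x) _
        rw [this, hvd, norm_smul, norm_smul, Real.norm_of_nonneg (hk0 _),
          Real.norm_of_nonneg (by positivity)]
      · have := hη0 (u x)
        positivity
      · rw [inv_mul_le_iff₀ hHpos, mul_one]
        exact hηH _
      · simp only [hv]
        rw [hηr _ (le_of_lt hx), inv_mul_cancel₀ hHpos.ne']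
    have energy : ∫ x, k (u x) * ‖fderiv ℝ u x‖ ^ 2 ≤ H * (F / 2) := by
      have h1 := neg_integral_mul_lapl_le hu hus hv1 (fun x => hη0 (u x)) (fun x => hηH (u x))
      rw [(integral_lapl_mul hu hus hv1).2, neg_neg] at h1
      have h2 : ∫ x, ∑ i : Fin n, fderiv ℝ v x (EuclideanSpace.single i 1) *
          fderiv ℝ u x (EuclideanSpace.single i 1) = ∫ x, k (u x) * ‖fderiv ℝ u x‖ ^ 2 := by
        congr 1
        ext x
        rw [norm_sq_eq_sum_apply_single, Finset.mul_sum, hvd]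
        refine Finset.sum_congr rfl fun i _ => ?_
        simp only [smul_apply, smul_eq_mul]
        ring
      rw [h2] at h1
      refine h1.trans ?_
      gcongr
    have layer : ∫ x, k (u x) ≤ A - B := by
      have hsub : {x | s + h < u x} ⊆ {x | s < u x} := fun x (hx : s + h < u x) =>
        show s < u x by linarith
      have hm := (measurableSet_superlevel hu.continuous s).diff
        (measurableSet_superlevel hu.continuous (s + h))
      have hT : volume ({x | s < u x} \ {x | s + h < u x}) ≠ ⊤ :=
        ne_top_of_le_ne_top (volume_superlevel_ne_top hus hs) (measure_mono Set.sdiff_subset)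
      rw [hA, hB, ← measureReal_sdiff hsub (measurableSet_superlevel hu.continuous _)
        (volume_superlevel_ne_top hus (by linarith)), ← integral_indicator_one hm]
      refine integral_mono i0 ((integrable_indicator_iff hm).mpr
        (integrableOn_const (C := (1 : ℝ)) hT)) fun x => ?_
      by_cases hx : x ∈ {x | s < u x} \ {x | s + h < u x}
      · rw [Set.indicator_of_mem hx]
        exact hk1 _
      · rw [Set.indicator_of_notMem hx]
        refine le_of_eq ?_
        rcases le_or_gt (u x) s with h1 | h1
        · exact hkl _ h1
        · refine hkr _ (le_of_lt ?_)
          by_contra h2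
          exact hx ⟨h1, h2⟩
    have cs := sq_integral_mul_le (fun x => hk0 (u x)) i0 i1 i2
    set P := ∫ x, k (u x) * ‖fderiv ℝ u x‖
    have hAB : 0 ≤ A - B := (integral_nonneg fun x => hk0 (u x)).trans layer
    set X := c * B ^ (1 - 1 / (n : ℝ)) with hX
    have hX0 : 0 ≤ X := by positivity
    have h3 : H * X ≤ P := by
      have := mul_le_mul_of_nonneg_left iso hHpos.le
      rwa [mul_inv_cancel_left₀ hHpos.ne'] at this
    have h4 : P ^ 2 ≤ H * (F / 2) * (A - B) :=
      cs.trans (mul_le_mul energy layer (integral_nonneg fun x => hk0 (u x)) (by positivity))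
    have h5 : H * (H * X ^ 2) ≤ H * (F / 2 * (A - B)) := by
      have : (H * X) ^ 2 ≤ P ^ 2 := by gcongr
      nlinarith
    have h6 := le_of_mul_le_mul_left h5 hHpos
    refine le_trans ?_ h6
    gcongr
  have hpow : (c * B ^ (1 - 1 / (n : ℝ))) ^ 2 = c ^ 2 * B ^ (2 - 2 / (n : ℝ)) := by
    rw [mul_pow, ← Real.rpow_natCast (B ^ _), ← Real.rpow_mul hB0]
    congr 2
    push_cast
    ring
  rw [mul_assoc, ← hpow]
  set Y := (c * B ^ (1 - 1 / (n : ℝ))) ^ 2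
  have hlim : Tendsto (fun δ : ℝ => (h - 2 * δ) * Y) (𝓝[>] 0) (𝓝 (h * Y)) := by
    have : Tendsto (fun δ : ℝ => (h - 2 * δ) * Y) (𝓝 0) (𝓝 ((h - 2 * 0) * Y)) :=
      Continuous.tendsto (by fun_prop) 0
    rw [mul_zero, sub_zero] at this
    exact this.mono_left nhdsWithin_le_nhds
  refine le_of_tendsto hlim ?_
  filter_upwards [Ioo_mem_nhdsGT (show (0 : ℝ) < h / 2 by linarith)] with δ hδ
  exact main δ hδ.1 (by linarith [hδ.2])

theorem tendsto_volume_superlevel {n : ℕ} {u : Euc n → ℝ} (hus : HasCompactSupport u) {s : ℝ}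
    (hs : 0 ≤ s) :
    Tendsto (fun k : ℕ => volume.real {x | s + 1 / ((k : ℝ) + 1) < u x}) atTop
      (𝓝 (volume.real {x | s < u x})) := by
  have hmono : Monotone fun k : ℕ => {x | s + 1 / ((k : ℝ) + 1) < u x} := by
    intro i j hij x hx
    have : 1 / ((j : ℝ) + 1) ≤ 1 / ((i : ℝ) + 1) := by gcongr
    simp only [Set.mem_ofPred_eq] at hx ⊢
    linarith
  have hU : ⋃ k : ℕ, {x | s + 1 / ((k : ℝ) + 1) < u x} = {x | s < u x} := by
    ext x
    simp only [Set.mem_iUnion, Set.mem_ofPred_eq]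
    constructor
    · rintro ⟨k, hk⟩
      have : 0 < 1 / ((k : ℝ) + 1) := by positivity
      linarith
    · intro hx
      obtain ⟨k, hk⟩ := exists_nat_one_div_lt (sub_pos.mpr hx)
      exact ⟨k, by linarith⟩
  have := tendsto_measure_iUnion_atTop (μ := volume) hmono
  rw [hU] at this
  exact (ENNReal.tendsto_toReal (volume_superlevel_ne_top hus hs)).comp this

/-- A monotone function satisfying a difference inequality at small steps to the right of each
point satisfies the integrated inequality. -/
theorem le_sub_of_difference_inequality {μ ψ : ℝ → ℝ} {c b : ℝ} (hc : 0 ≤ c) (hb : 0 ≤ b)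
    (hμ : ∀ s t, 0 ≤ s → s ≤ t → μ t ≤ μ s) (hμ0 : ∀ s, 0 ≤ μ s)
    (hr : ∀ s, 0 ≤ s → Tendsto (fun k : ℕ => μ (s + 1 / ((k : ℝ) + 1))) atTop (𝓝 (μ s)))
    (hd : ∀ s h, 0 ≤ s → 0 < h → h * c * μ (s + h) ^ b ≤ μ s - μ (s + h))
    (hψ : ∀ x y, 0 < y → y ≤ x → (x - y) * x ^ (-b) ≤ ψ y - ψ x)
    {S : ℝ} (hS : 0 ≤ S) (hS0 : 0 < μ S) : c * S ≤ ψ (μ S) - ψ (μ 0) := by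
  have hpos : ∀ s, 0 ≤ s → s ≤ S → 0 < μ s := fun s h0 hs => hS0.trans_le (hμ s S h0 hs)
  have hψμ : ∀ s t, 0 ≤ s → s ≤ t → t ≤ S → ψ (μ s) ≤ ψ (μ t) := by
    intro s t h0 hst ht
    have h1 := hψ (μ s) (μ t) (hpos t (h0.trans hst) ht) (hμ s t h0 hst)
    have h2 : 0 ≤ (μ s - μ t) * μ s ^ (-b) :=
      mul_nonneg (sub_nonneg.mpr (hμ s t h0 hst)) (Real.rpow_nonneg (hμ0 s) _)
    linarith
  have key : ∀ θ, 0 ≤ θ → θ < 1 → θ * c * S ≤ ψ (μ S) - ψ (μ 0) := by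
    intro θ hθ0 hθ1
    rcases hc.eq_or_lt with rfl | hc
    · have := hψμ 0 S le_rfl hS le_rfl
      simp
      linarith
    set T := {s | 0 ≤ s ∧ s ≤ S ∧ θ * c * s ≤ ψ (μ s) - ψ (μ 0)} with hT
    have h0T : (0 : ℝ) ∈ T := ⟨le_rfl, hS, by simp⟩
    have hTb : BddAbove T := ⟨S, fun s hs => hs.2.1⟩
    set σ := sSup T with hσ
    have hσ0 : 0 ≤ σ := le_csSup hTb h0T
    have hσS : σ ≤ S := csSup_le ⟨0, h0T⟩ fun s hs => hs.2.1
    have hσT : θ * c * σ ≤ ψ (μ σ) - ψ (μ 0) := by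
      refine le_of_forall_lt_imp_le_of_dense fun a ha => ?_
      rcases hθ0.eq_or_lt with rfl | hθ
      · have := hψμ 0 σ le_rfl hσ0 hσS
        linarith
      have hθc : 0 < θ * c := mul_pos hθ hc
      have : a / (θ * c) < σ := by rwa [div_lt_iff₀' hθc]
      obtain ⟨s, hs, has⟩ := exists_lt_of_lt_csSup ⟨0, h0T⟩ this
      rw [div_lt_iff₀' hθc] at has
      have := hψμ s σ hs.1 (le_csSup hTb hs) hσS
      linarith [hs.2.2]
    rcases hσS.eq_or_lt with h | h
    · rwa [h] at hσT
    exfalso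
    have hμσ := hpos σ hσ0 hσS
    have hlim : Tendsto (fun k : ℕ => (μ (σ + 1 / ((k : ℝ) + 1)) / μ σ) ^ b) atTop (𝓝 1) := by
      have h1 := ((hr σ hσ0).div_const (μ σ)).rpow_const (p := b) (Or.inr hb)
      rwa [div_self hμσ.ne', Real.one_rpow] at h1
    have hstep := (tendsto_one_div_add_atTop_nhds_zero_nat (𝕜 := ℝ)).eventually
      (gt_mem_nhds (sub_pos.mpr h))
    obtain ⟨k, hk1, hk2⟩ := ((hlim.eventually (lt_mem_nhds hθ1)).and hstep).exists
    set d := 1 / ((k : ℝ) + 1) with hdd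
    have hd0 : 0 < d := by positivity
    have hle : σ + d ≤ S := by linarith
    have hμd := hpos _ (by linarith) hle
    have h1 := hψ (μ σ) (μ (σ + d)) hμd (hμ _ _ hσ0 (by linarith))
    have h2 := hd σ d hσ0 hd0
    have h3 : d * c * (μ (σ + d) / μ σ) ^ b ≤ (μ σ - μ (σ + d)) * μ σ ^ (-b) := by
      rw [Real.div_rpow hμd.le hμσ.le, Real.rpow_neg hμσ.le, div_eq_mul_inv, ← mul_assoc]
      gcongr
    have h4 : d * c * θ ≤ d * c * (μ (σ + d) / μ σ) ^ b := by gcongr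
    have : σ + d ∈ T := ⟨by linarith, hle, by
      calc θ * c * (σ + d) = θ * c * σ + d * c * θ := by ring
        _ ≤ _ := by linarith⟩
    have := le_csSup hTb this
    linarith
  have hlim : Tendsto (fun θ : ℝ => θ * c * S) (𝓝[<] 1) (𝓝 (1 * c * S)) :=
    (Continuous.tendsto (by fun_prop) 1).mono_left nhdsWithin_le_nhds
  rw [one_mul] at hlim
  refine le_of_tendsto hlim ?_
  filter_upwards [Ioo_mem_nhdsLT (zero_lt_one' ℝ)] with θ hθ
  exact key θ hθ.1.le hθ.2

theorem superlevel_estimate {n : ℕ} (hn : 2 ≤ n) {u : Euc n → ℝ} (hu : ContDiff ℝ 2 u)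
    (hus : HasCompactSupport u) {F : ℝ} (hF0 : 0 < F) (hF : ∫ x, |lapl n u x| ≤ F) {ψ : ℝ → ℝ}
    (hψ : ∀ x y, 0 < y → y ≤ x → (x - y) * x ^ (-(2 - 2 / (n : ℝ))) ≤ ψ y - ψ x)
    {s : ℝ} (hs : 0 ≤ s) (hs0 : 0 < volume.real {x | s < u x}) :
    isoConst n ^ 2 / (F / 2) * s ≤
      ψ (volume.real {x | s < u x}) - ψ (volume.real {x | 0 < u x}) := by
  have hn' : (2 : ℝ) ≤ n := by exact_mod_cast hn
  refine le_sub_of_difference_inequality (μ := fun s => volume.real {x | s < u x})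
    (b := 2 - 2 / (n : ℝ)) (by positivity) ?_ (fun s t h0 hst => ?_) (fun _ => measureReal_nonneg)
    (fun s h0 => tendsto_volume_superlevel hus h0) (fun s h h0 hh => ?_) hψ hs hs0
  · rw [sub_nonneg, div_le_iff₀ (by linarith)]
    linarith
  · exact measureReal_mono (fun x (hx : t < u x) => show s < u x from hst.trans_lt hx)
      (volume_superlevel_ne_top hus h0)
  · have := volume_superlevel_sub_ge hn hu hus hF h0 hh
    have h2 : h * (isoConst n ^ 2 / (F / 2)) * volume.real {x | s + h < u x} ^ (2 - 2 / (n : ℝ)) =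
        h * isoConst n ^ 2 * volume.real {x | s + h < u x} ^ (2 - 2 / (n : ℝ)) / (F / 2) := by ring
    rw [h2, div_le_iff₀' (by positivity)]
    exact this

theorem one_sub_mul_le_rpow_neg {a r : ℝ} (ha : 0 ≤ a) (hr : 0 < r) :
    1 - a * (r - 1) ≤ r ^ (-a) := by
  rw [Real.rpow_def_of_pos hr]
  have h1 := Real.add_one_le_exp (Real.log r * -a)
  have h2 := mul_le_mul_of_nonneg_left (Real.log_le_sub_one_of_pos hr) ha
  linarith

theorem sub_mul_rpow_le_rpow_neg_sub {a x y : ℝ} (ha : 0 < a) (hy : 0 < y) (hxy : y ≤ x) :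
    (x - y) * x ^ (-(1 + a)) ≤ y ^ (-a) / a - x ^ (-a) / a := by
  have hx : 0 < x := hy.trans_le hxy
  have h := one_sub_mul_le_rpow_neg ha.le (div_pos hy hx)
  have h1 := mul_le_mul_of_nonneg_right h (Real.rpow_nonneg hx.le (-a))
  rw [Real.div_rpow hy.le hx.le, div_mul_cancel₀ _ (Real.rpow_pos_of_pos hx _).ne'] at h1
  rw [← sub_div, le_div_iff₀ ha, neg_add, Real.rpow_add hx, Real.rpow_neg_one]
  have : (x - y) * (x⁻¹ * x ^ (-a)) * a = (1 - a * (y / x - 1)) * x ^ (-a) - x ^ (-a) := by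
    field_simp
    ring
  linarith

theorem sub_mul_rpow_le_neg_log_sub {x y : ℝ} (hy : 0 < y) (hxy : y ≤ x) :
    (x - y) * x ^ (-1 : ℝ) ≤ -Real.log y - -Real.log x := by
  have hx : 0 < x := hy.trans_le hxy
  have := Real.log_le_sub_one_of_pos (div_pos hy hx)
  rw [Real.log_div hy.ne' hx.ne'] at this
  rw [Real.rpow_neg_one, sub_mul, mul_inv_cancel₀ hx.ne', ← div_eq_mul_inv]
  linarith

/-- The map `r ↦ r ^ (-a)` is superadditive along shifts that are uniform in both arguments. -/
theorem rpow_neg_add_le {a x y X Y d : ℝ} (ha : 0 < a) (hx : 0 < x) (hy : 0 < y) (hX : 0 < X)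
    (hY : 0 < Y) (hd : 0 ≤ d) (h1 : X ^ (-a) + d ≤ x ^ (-a)) (h2 : Y ^ (-a) + d ≤ y ^ (-a)) :
    (X + Y) ^ (-a) + d * 2 ^ (-a) ≤ (x + y) ^ (-a) := by
  set σ := x + y with hσ
  have hσ0 : 0 < σ := by positivity
  have ratio : ∀ {z Z : ℝ}, 0 < z → 0 < Z → Z ^ (-a) + d ≤ z ^ (-a) →
      (Z / z) ^ (-a) ≤ 1 - d * z ^ a := by
    intro z Z hz hZ h
    have hza := Real.rpow_pos_of_pos hz a
    rw [Real.div_rpow hZ.le hz.le, Real.rpow_neg hz.le, div_inv_eq_mul]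
    rw [Real.rpow_neg hz.le] at h
    have := mul_le_mul_of_nonneg_right h hza.le
    rw [inv_mul_cancel₀ hza.ne'] at this
    linarith
  set m := (X + Y) / σ with hm
  have hm0 : 0 < m := by positivity
  have tangent : ∀ z : ℝ, 0 < z → m ^ (-a) * (1 - a * (z / m - 1)) ≤ z ^ (-a) := by
    intro z hz
    have := mul_le_mul_of_nonneg_left (one_sub_mul_le_rpow_neg ha.le (div_pos hz hm0))
      (Real.rpow_nonneg hm0.le (-a))
    rwa [Real.div_rpow hz.le hm0.le, mul_div_cancel₀ _ (Real.rpow_pos_of_pos hm0 _).ne'] at this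
  have jensen : σ * m ^ (-a) ≤ x * (X / x) ^ (-a) + y * (Y / y) ^ (-a) := by
    have e1 := mul_le_mul_of_nonneg_left (tangent (X / x) (by positivity)) hx.le
    have e2 := mul_le_mul_of_nonneg_left (tangent (Y / y) (by positivity)) hy.le
    have e3 : x * (m ^ (-a) * (1 - a * (X / x / m - 1))) +
        y * (m ^ (-a) * (1 - a * (Y / y / m - 1))) = σ * m ^ (-a) := by
      have : x * (X / x / m) + y * (Y / y / m) = σ := by
        rw [hm]
        field_simp
      calc _ = m ^ (-a) * (σ - a * (x * (X / x / m) + y * (Y / y / m) - σ)) := by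
            rw [hσ]; ring
        _ = _ := by rw [this]; ring
    linarith
  have power : σ * (σ / 2) ^ a ≤ x * x ^ a + y * y ^ a := by
    have := (convexOn_rpow (p := 1 + a) (by linarith)).2 (Set.mem_Ici.mpr hx.le)
      (Set.mem_Ici.mpr hy.le) (show (0 : ℝ) ≤ 1 / 2 by norm_num) (show (0 : ℝ) ≤ 1 / 2 by norm_num)
      (by norm_num)
    simp only [smul_eq_mul] at this
    rw [← mul_add, ← hσ, show 1 / 2 * σ = σ / 2 by ring, Real.rpow_add (by positivity),
      Real.rpow_add hx, Real.rpow_add hy, Real.rpow_one, Real.rpow_one, Real.rpow_one] at this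
    linarith
  have e1 := mul_le_mul_of_nonneg_left (ratio hx hX h1) hx.le
  have e2 := mul_le_mul_of_nonneg_left (ratio hy hY h2) hy.le
  have e3 := mul_le_mul_of_nonneg_left power hd
  have e4 : σ * m ^ (-a) ≤ σ * (1 - d * (σ / 2) ^ a) := by
    have : x + y = σ := rfl
    nlinarith
  have e5 := le_of_mul_le_mul_left e4 hσ0
  have e6 := mul_le_mul_of_nonneg_right e5 (Real.rpow_nonneg hσ0.le (-a))
  have hσa : σ ^ a * σ ^ (-a) = 1 := by rw [← Real.rpow_add hσ0, add_neg_cancel, Real.rpow_zero]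
  rw [hm, Real.div_rpow (by positivity) hσ0.le,
    div_mul_cancel₀ _ (Real.rpow_pos_of_pos hσ0 _).ne', Real.div_rpow hσ0.le zero_le_two] at e6
  have : (1 - d * (σ ^ a / 2 ^ a)) * σ ^ (-a) = σ ^ (-a) - d * 2 ^ (-a) := by
    rw [Real.rpow_neg zero_le_two, sub_mul, one_mul, div_eq_mul_inv]
    linear_combination (-d * (2 ^ a)⁻¹) * hσa
  linarith

theorem omegaS_div_eq_volume_ball {n : ℕ} (hn : 2 ≤ n) :
    omegaS n / n = (volume (Metric.ball (0 : Euc n) 1)).toReal := by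
  have hn' : (2 : ℝ) ≤ n := by exact_mod_cast hn
  have : Nonempty (Fin n) := ⟨⟨0, by omega⟩⟩
  have hG : Real.Gamma ((n : ℝ) / 2 + 1) = n / 2 * Real.Gamma ((n : ℝ) / 2) :=
    Real.Gamma_add_one (by positivity)
  have hG0 : 0 < Real.Gamma ((n : ℝ) / 2) := Real.Gamma_pos_of_pos (by positivity)
  have hpi : √Real.pi ^ n = Real.pi ^ ((n : ℝ) / 2) := by
    rw [Real.sqrt_eq_rpow, ← Real.rpow_natCast, ← Real.rpow_mul Real.pi_pos.le]
    congr 1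
    ring
  rw [EuclideanSpace.volume_ball, Fintype.card_fin, ENNReal.ofReal_one, one_pow, one_mul, hG, hpi,
    ENNReal.toReal_ofReal (by positivity), omegaS]
  field_simp

theorem isoConst_eq {n : ℕ} (hn : 2 ≤ n) : isoConst n = n * (omegaS n / n) ^ (1 / (n : ℝ)) := by
  rw [isoConst, omegaS_div_eq_volume_ball hn]

theorem omegaS_pos {n : ℕ} (hn : 2 ≤ n) : 0 < omegaS n := by
  have hn' : (2 : ℝ) ≤ n := by exact_mod_cast hn
  have hG0 : 0 < Real.Gamma ((n : ℝ) / 2) := Real.Gamma_pos_of_pos (by positivity)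
  rw [omegaS]
  positivity

theorem isoConst_two_sq : isoConst 2 ^ 2 = 4 * Real.pi := by
  have : omegaS 2 = 2 * Real.pi := by simp [omegaS]
  rw [isoConst_eq le_rfl, this, mul_pow]
  push_cast
  rw [mul_div_cancel_left₀ _ two_ne_zero, ← Real.sqrt_eq_rpow, Real.sq_sqrt Real.pi_pos.le]
  norm_num

theorem isoConst_sq_mul_cConst {n : ℕ} (hn : 3 ≤ n) :
    (1 - 2 / (n : ℝ)) * isoConst n ^ 2 *
      (cConst n * (omegaS n / n) ^ (((n : ℝ) - 2) / n)) = 1 := by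
  have hn' : (3 : ℝ) ≤ n := by exact_mod_cast hn
  have hω := omegaS_pos (show 2 ≤ n by omega)
  have hn0 : (n : ℝ) ≠ 0 := by positivity
  have hn2 : (n : ℝ) - 2 ≠ 0 := by linarith
  set κ := omegaS n / n with hκ
  have hκ0 : 0 < κ := by positivity
  have h1 : (κ ^ (1 / (n : ℝ))) ^ 2 * κ ^ (((n : ℝ) - 2) / n) = κ := by
    rw [← Real.rpow_natCast, ← Real.rpow_mul hκ0.le, ← Real.rpow_add hκ0]
    convert Real.rpow_one κ using 2
    push_cast
    field_simp
    ring
  rw [isoConst_eq (by omega), cConst, ← hκ, mul_pow]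
  have h2 : omegaS n = n * κ := by rw [hκ]; field_simp
  rw [h2]
  calc _ = (1 - 2 / (n : ℝ)) * n ^ 2 * (1 / ((n - 2) * (n * κ))) *
        ((κ ^ (1 / (n : ℝ))) ^ 2 * κ ^ (((n : ℝ) - 2) / n)) := by ring
    _ = 1 := by
      rw [h1]
      field_simp

theorem lapl_neg {n : ℕ} {u : Euc n → ℝ} (x : Euc n) :
    lapl n (fun x => -u x) x = -lapl n u x := by
  have : iteratedFDeriv ℝ 2 (fun x => -u x) x = -iteratedFDeriv ℝ 2 u x :=
    iteratedFDeriv_neg_apply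
  simp [lapl, this]

theorem NstarV_of_three_le {n : ℕ} (hn : 3 ≤ n) (V t : ℝ) :
    NstarV n V t = cConst n * (omegaS n / n) ^ (((n : ℝ) - 2) / n) *
      (t ^ (-(1 - 2 / (n : ℝ))) - V ^ (-(1 - 2 / (n : ℝ)))) := by
  have hn0 : (n : ℝ) ≠ 0 := by positivity
  have : ((n : ℝ) - 2) / n = 1 - 2 / n := by field_simp
  rw [NstarV, if_neg (by omega), this]

theorem superlevel_le_exp {u : Euc 2 → ℝ} (hu : ContDiff ℝ 2 u) (hus : HasCompactSupport u)
    {F : ℝ} (hF0 : 0 < F) (hF : ∫ x, |lapl 2 u x| ≤ F) {s : ℝ} (hs : 0 ≤ s) :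
    volume.real {x | s < u x} ≤
      volume.real {x | 0 < u x} * Real.exp (-(8 * Real.pi / F * s)) := by
  rcases (measureReal_nonneg (μ := volume) (s := {x | s < u x})).eq_or_lt with h0 | h0
  · rw [← h0]
    positivity
  have h1 : 0 < volume.real {x | 0 < u x} :=
    h0.trans_le (measureReal_mono (fun x (hx : s < u x) => show 0 < u x from hs.trans_lt hx)
      (volume_superlevel_ne_top hus le_rfl))
  have h := superlevel_estimate le_rfl hu hus hF0 hF (ψ := fun x => -Real.log x)
    (fun x y hy hxy => by
      have := sub_mul_rpow_le_neg_log_sub hy hxy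
      convert this using 3
      norm_num) hs h0
  rw [isoConst_two_sq] at h
  rw [← Real.log_le_log_iff h0 (by positivity), Real.log_mul h1.ne' (Real.exp_ne_zero _),
    Real.log_exp]
  have : 4 * Real.pi / (F / 2) * s = 8 * Real.pi / F * s := by
    field_simp
    ring
  linarith

theorem superlevel_rpow_neg_ge {n : ℕ} (hn : 3 ≤ n) {u : Euc n → ℝ} (hu : ContDiff ℝ 2 u)
    (hus : HasCompactSupport u) {F : ℝ} (hF0 : 0 < F) (hF : ∫ x, |lapl n u x| ≤ F) {s : ℝ}
    (hs : 0 ≤ s) (hs0 : 0 < volume.real {x | s < u x}) :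
    volume.real {x | 0 < u x} ^ (-(1 - 2 / (n : ℝ))) +
      2 * s / (cConst n * (omegaS n / n) ^ (((n : ℝ) - 2) / n) * F) ≤
      volume.real {x | s < u x} ^ (-(1 - 2 / (n : ℝ))) := by
  have hn' : (3 : ℝ) ≤ n := by exact_mod_cast hn
  have ha : 0 < 1 - 2 / (n : ℝ) := by
    rw [sub_pos, div_lt_one (by linarith)]
    linarith
  have h := superlevel_estimate (by omega) hu hus hF0 hF
    (ψ := fun x => x ^ (-(1 - 2 / (n : ℝ))) / (1 - 2 / (n : ℝ)))
    (fun x y hy hxy => by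
      have := sub_mul_rpow_le_rpow_neg_sub ha hy hxy
      convert this using 3
      ring) hs hs0
  have hK := isoConst_sq_mul_cConst hn
  set K := cConst n * (omegaS n / n) ^ (((n : ℝ) - 2) / n)
  have hK0 : K ≠ 0 := by
    rintro h0
    rw [h0, mul_zero] at hK
    exact zero_ne_one hK
  rw [← sub_div, le_div_iff₀ ha] at h
  have : isoConst n ^ 2 / (F / 2) * s * (1 - 2 / (n : ℝ)) = 2 * s / (K * F) := by
    rw [eq_div_iff (by positivity)]
    calc _ = 2 * s * ((1 - 2 / (n : ℝ)) * isoConst n ^ 2 * K) * (F / F) := by ring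
      _ = _ := by rw [hK, div_self hF0.ne', mul_one, mul_one]
  linarith

theorem volume_abs_superlevel_le {n : ℕ} (hn : 2 ≤ n) {φ : Euc n → ℝ} (hφ : ContDiff ℝ 2 φ)
    (hφs : HasCompactSupport φ) {W t F s : ℝ} (hW : volume.real {x | φ x ≠ 0} ≤ W) (ht : 0 < t)
    (htW : t ≤ W) (hF0 : 0 < F) (hF : ∫ x, |lapl n φ x| ≤ F) (hs : 0 ≤ s)
    (hsN : (2 : ℝ) ^ (-(2 / (n : ℝ))) * NstarV n W t * F ≤ s) :
    volume {x | s < |φ x|} ≤ ENNReal.ofReal t := by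
  have hn' : (2 : ℝ) ≤ n := by exact_mod_cast hn
  have hφ' : ContDiff ℝ 2 fun x => -φ x := hφ.neg
  have hφs' : HasCompactSupport fun x => -φ x := hφs.comp_left (g := fun r => -r) neg_zero
  have hF' : ∫ x, |lapl n (fun x => -φ x) x| ≤ F := by
    simpa only [lapl_neg, abs_neg] using hF
  set X := volume.real {x | 0 < φ x} with hX
  set Y := volume.real {x | 0 < -φ x} with hY
  set x := volume.real {x | s < φ x} with hx
  set y := volume.real {x | s < -φ x} with hy
  have hW0 : 0 < W := ht.trans_le htW
  have hXY : X + Y ≤ W := by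
    refine le_trans (le_of_eq ?_) hW
    rw [hX, hY, ← measureReal_union ?_ (measurableSet_superlevel hφ'.continuous 0)
      (volume_superlevel_ne_top hφs le_rfl) (volume_superlevel_ne_top hφs' le_rfl)]
    · congr 1
      ext z
      simp only [Set.mem_union, Set.mem_ofPred_eq, Left.neg_pos_iff]
      rw [or_comm, ← lt_or_lt_iff_ne]
    · rw [Set.disjoint_left]
      intro z (hz : 0 < φ z) (hz' : 0 < -φ z)
      linarith
  have hxX : x ≤ X := measureReal_mono (fun z (hz : s < φ z) => show 0 < φ z from hs.trans_lt hz)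
    (volume_superlevel_ne_top hφs le_rfl)
  have hyY : y ≤ Y := measureReal_mono
    (fun z (hz : s < -φ z) => show 0 < -φ z from hs.trans_lt hz)
    (volume_superlevel_ne_top hφs' le_rfl)
  have hx0 : 0 ≤ x := measureReal_nonneg
  have hy0 : 0 ≤ y := measureReal_nonneg
  suffices hxy : x + y ≤ t by
    have hsub : {x | s < |φ x|} ⊆ {x | s < φ x} ∪ {x | s < -φ x} := fun z (hz : s < |φ z|) =>
      lt_abs.mp hz
    calc volume {x | s < |φ x|} ≤ volume {x | s < φ x} + volume {x | s < -φ x} :=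
          (measure_mono hsub).trans (measure_union_le _ _)
      _ = ENNReal.ofReal (x + y) := by
          rw [ENNReal.ofReal_add hx0 hy0, hx, hy,
            ofReal_measureReal (volume_superlevel_ne_top hφs hs),
            ofReal_measureReal (volume_superlevel_ne_top hφs' hs)]
      _ ≤ ENNReal.ofReal t := ENNReal.ofReal_le_ofReal hxy
  rcases hn.eq_or_lt with rfl | hn3
  · have h1 := superlevel_le_exp hφ hφs hF0 hF hs
    have h2 := superlevel_le_exp hφ' hφs' hF0 hF' hs
    have hpi := Real.pi_pos
    have h3 : Real.log (W / t) ≤ 8 * Real.pi / F * s := by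
      rw [NstarV, if_pos rfl] at hsN
      have e : (2 : ℝ) ^ (-(2 / ((2 : ℕ) : ℝ))) = 1 / 2 := by
        push_cast
        rw [div_self two_ne_zero, Real.rpow_neg_one]
        norm_num
      rw [e] at hsN
      have := mul_le_mul_of_nonneg_left hsN (show 0 ≤ 8 * Real.pi / F by positivity)
      refine le_trans (le_of_eq ?_) this
      field_simp
      ring
    have h4 : Real.exp (-(8 * Real.pi / F * s)) ≤ t / W := by
      rw [← Real.le_log_iff_exp_le (by positivity), ← inv_div W t, Real.log_inv]
      linarith
    calc x + y ≤ (X + Y) * Real.exp (-(8 * Real.pi / F * s)) := by linarith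
      _ ≤ W * (t / W) := by gcongr
      _ = t := by field_simp
  · have hn'' : (3 : ℝ) ≤ n := by exact_mod_cast hn3
    have ha : 0 < 1 - 2 / (n : ℝ) := by
      rw [sub_pos, div_lt_one (by linarith)]
      linarith
    have h1 := superlevel_rpow_neg_ge hn3 hφ hφs hF0 hF hs
    have h2 := superlevel_rpow_neg_ge hn3 hφ' hφs' hF0 hF' hs
    rw [NstarV_of_three_le hn3] at hsN
    have hω := omegaS_pos hn
    have hK : 0 < cConst n * (omegaS n / n) ^ (((n : ℝ) - 2) / n) := by
      have : (0 : ℝ) < n - 2 := by linarith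
      rw [cConst]
      positivity
    set K := cConst n * (omegaS n / n) ^ (((n : ℝ) - 2) / n)
    set d := 2 * s / (K * F) with hd
    have h2n : (2 : ℝ) ^ (-(2 / (n : ℝ))) = 2 ^ (1 - 2 / (n : ℝ)) / 2 := by
      rw [← Real.rpow_sub_one two_ne_zero]
      congr 1
      ring
    rw [h2n] at hsN
    set a := 1 - 2 / (n : ℝ) with haa
    have hd0 : 0 ≤ d := by positivity
    have hdt : t ^ (-a) - W ^ (-a) ≤ d * 2 ^ (-a) := by
      rw [Real.rpow_neg zero_le_two, ← div_eq_mul_inv, le_div_iff₀ (by positivity), hd,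
        le_div_iff₀ (by positivity)]
      linarith
    have h2a : (2 : ℝ) ^ (-a) ≤ 1 := Real.rpow_le_one_of_one_le_of_nonpos one_le_two (by linarith)
    have hd1 : d * 2 ^ (-a) ≤ d := mul_le_of_le_one_right hd0 h2a
    have conclude : ∀ z Z : ℝ, 0 < z → z ≤ Z → Z ≤ W → Z ^ (-a) + d * 2 ^ (-a) ≤ z ^ (-a) →
        z ≤ t := by
      intro z Z hz hzZ hZW h
      have := Real.rpow_le_rpow_of_nonpos (hz.trans_le hzZ) hZW (by linarith : -a ≤ 0)
      exact (Real.rpow_le_rpow_iff_of_neg ht hz (by linarith : -a < 0)).mp (by linarith)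
    rcases hx0.eq_or_lt with hx0 | hx0
    · rcases hy0.eq_or_lt with hy0 | hy0
      · linarith
      · rw [← hx0, zero_add]
        exact conclude y Y hy0 hyY (by linarith) (by linarith [h2 hy0])
    rcases hy0.eq_or_lt with hy0 | hy0
    · rw [← hy0, add_zero]
      exact conclude x X hx0 hxX (by linarith) (by linarith [h1 hx0])
    · exact conclude (x + y) (X + Y) (by linarith) (by linarith) hXY
        (rpow_neg_add_le ha hx0 hy0 (by linarith) (by linarith) hd0 (h1 hx0) (h2 hy0))

theorem IsTestFun.contDiff_two {n : ℕ} {Ω : Set (Euc n)} {φ : Euc n → ℝ} (h : IsTestFun n Ω φ) :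
    ContDiff ℝ 2 φ :=
  contDiff_infty.mp h.1 2

theorem IsTestFun.setOf_ne_zero_subset {n : ℕ} {Ω : Set (Euc n)} {φ : Euc n → ℝ}
    (h : IsTestFun n Ω φ) : {x | φ x ≠ 0} ⊆ Ω :=
  (subset_tsupport φ).trans h.2.2

theorem IsTestFun.integral_abs_lapl_le {n : ℕ} {Ω : Set (Euc n)} {φ f : Euc n → ℝ}
    (h : IsTestFun n Ω φ) (hf : IntegrableOn f Ω) :
    ∫ x, |lapl n φ x| ≤ (∫ x in Ω, |lapl n φ x - f x|) + L1norm n Ω f := by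
  have hl : IntegrableOn (lapl n φ) Ω := (integrable_lapl h.contDiff_two h.2.1).integrableOn
  have h0 : ∀ x, x ∉ Ω → |lapl n φ x| = 0 := fun x hx => by
    rw [abs_eq_zero]
    by_contra h1
    exact hx (h.2.2 (tsupport_lapl_subset h.contDiff_two (subset_tsupport _ h1)))
  have hsub : IntegrableOn (fun x => |lapl n φ x - f x|) Ω := (hl.sub hf).abs
  rw [← setIntegral_eq_integral_of_forall_compl_eq_zero h0, L1norm, ← integral_add hsub hf.abs]
  refine integral_mono hl.abs (hsub.add hf.abs) fun x => ?_
  simpa using abs_add_le (lapl n φ x - f x) (f x)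

/-- A superlevel set estimate for test functions passes to the closure. -/
theorem decRearr_le_of_forall_isTestFun {n : ℕ} {Ω : Set (Euc n)} {u f : Euc n → ℝ}
    (hu : MemW21Delta0 n Ω u f) {M t : ℝ} (hM : 0 ≤ M)
    (H : ∀ φ, IsTestFun n Ω φ → ∀ F s, 0 < F → ∫ x, |lapl n φ x| ≤ F → 0 ≤ s → M * F ≤ s →
      volume {x | s < |φ x|} ≤ ENNReal.ofReal t) :
    decRearr n Ω u t ≤ M * L1norm n Ω f := by
  obtain ⟨hui, hfi, φ, hφ, hφu, hφf⟩ := hu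
  have hL : 0 ≤ L1norm n Ω f := integral_nonneg fun x => abs_nonneg _
  set L := L1norm n Ω f
  have hML : 0 ≤ M * L := mul_nonneg hM hL
  refine le_of_forall_gt_imp_ge_of_dense fun s hs => ?_
  refine csInf_le ⟨0, fun r hr => hr.1⟩ ⟨by linarith, ?_⟩
  set s' := (s + M * L) / 2 with hs'
  set ε := (s' - M * L) / (M + 1) with hε
  have hε0 : 0 < ε := div_pos (by linarith) (by linarith)
  have hMε : M * (L + ε) ≤ s' := by
    have : ε * (M + 1) = s' - M * L := div_mul_cancel₀ _ (by linarith)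
    linarith
  have hδ : 0 < s - s' := by linarith
  have hφi : ∀ k, IntegrableOn (φ k) Ω := fun k =>
    ((hφ k).1.continuous.integrable_of_hasCompactSupport (hφ k).2.1).integrableOn
  have bound : ∀ᶠ k in atTop, volume {x ∈ Ω | s < |u x|} ≤ ENNReal.ofReal t +
      ENNReal.ofReal (∫ x in Ω, |φ k x - u x|) / ENNReal.ofReal (s - s') := by
    filter_upwards [hφf.eventually (gt_mem_nhds hε0)] with k hk
    have h1 := H (φ k) (hφ k) (L + ε) s' (by linarith)
      (by linarith [(hφ k).integral_abs_lapl_le hfi]) (by linarith) hMε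
    have hi : IntegrableOn (fun x => |φ k x - u x|) Ω := ((hφi k).sub hui).abs
    have h2 : volume ({x | ENNReal.ofReal (s - s') ≤ ENNReal.ofReal |φ k x - u x|} ∩ Ω) ≤
        ENNReal.ofReal (∫ x in Ω, |φ k x - u x|) / ENNReal.ofReal (s - s') := by
      rw [ofReal_integral_eq_lintegral_ofReal hi (ae_of_all _ fun x => abs_nonneg _)]
      exact (Measure.le_restrict_apply _ _).trans
        (meas_ge_le_lintegral_div hi.aemeasurable.ennreal_ofReal
          (ENNReal.ofReal_pos.mpr hδ).ne' ENNReal.ofReal_ne_top)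
    refine (measure_mono ?_).trans ((measure_union_le _ _).trans (add_le_add h1 h2))
    rintro x ⟨hxΩ, hx⟩
    by_cases hx' : s' < |φ k x|
    · exact Or.inl hx'
    · refine Or.inr ⟨ENNReal.ofReal_le_ofReal ?_, hxΩ⟩
      have := abs_sub_abs_le_abs_sub (u x) (φ k x)
      rw [abs_sub_comm (φ k x)]
      linarith
  refine ge_of_tendsto ?_ bound
  have h1 := ENNReal.Tendsto.div_const (ENNReal.tendsto_ofReal hφu)
    (Or.inr (ENNReal.ofReal_pos.mpr hδ).ne')
  rw [ENNReal.ofReal_zero, ENNReal.zero_div] at h1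
  simpa using h1.const_add (ENNReal.ofReal t)

theorem cConst_mul_rpow_nonneg {n : ℕ} (hn : 3 ≤ n) :
    0 ≤ cConst n * (omegaS n / n) ^ (((n : ℝ) - 2) / n) := by
  have hn' : (3 : ℝ) ≤ n := by exact_mod_cast hn
  have hω := omegaS_pos (show 2 ≤ n by omega)
  have : (0 : ℝ) < n - 2 := by linarith
  rw [cConst]
  positivity

theorem NstarV_nonneg {n : ℕ} (hn : 2 ≤ n) {V t : ℝ} (ht : 0 < t) (htV : t ≤ V) :
    0 ≤ NstarV n V t := by
  rcases hn.eq_or_lt with rfl | hn3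
  · rw [NstarV, if_pos rfl]
    exact mul_nonneg (by positivity) (Real.log_nonneg ((one_le_div ht).mpr htV))
  · have hn' : (3 : ℝ) ≤ n := by exact_mod_cast hn3
    rw [NstarV, if_neg (by omega)]
    refine mul_nonneg (cConst_mul_rpow_nonneg hn3) (sub_nonneg.mpr ?_)
    exact Real.rpow_le_rpow_of_nonpos ht htV
      (neg_nonpos.mpr (div_nonneg (by linarith) (by linarith)))

theorem NstarV_le_NstarInf {n : ℕ} (hn : 3 ≤ n) {V t : ℝ} (hV : 0 ≤ V) :
    NstarV n V t ≤ NstarInf n t := by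
  rw [NstarV, if_neg (by omega), NstarInf]
  exact mul_le_mul_of_nonneg_left (sub_le_self _ (Real.rpow_nonneg hV _))
    (cConst_mul_rpow_nonneg hn)

theorem decRearr_le_NstarV {n : ℕ} (hn : 2 ≤ n) {Ω : Set (Euc n)} (hΩ : volume Ω ≠ ⊤)
    {u f : Euc n → ℝ} (hu : MemW21Delta0 n Ω u f) {t : ℝ} (ht : 0 < t)
    (htΩ : t ≤ (volume Ω).toReal) :
    decRearr n Ω u t ≤
      (2 : ℝ) ^ (-(2 / (n : ℝ))) * NstarV n (volume Ω).toReal t * L1norm n Ω f :=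
  decRearr_le_of_forall_isTestFun hu
    (mul_nonneg (Real.rpow_nonneg zero_le_two _) (NstarV_nonneg hn ht htΩ))
    fun _ hφ _ _ hF0 hF hs hsN => volume_abs_superlevel_le hn hφ.contDiff_two hφ.2.1
      (measureReal_mono hφ.setOf_ne_zero_subset hΩ) ht htΩ hF0 hF hs hsN

theorem decRearr_le_NstarInf {n : ℕ} (hn : 3 ≤ n) {Ω : Set (Euc n)} {u f : Euc n → ℝ}
    (hu : MemW21Delta0 n Ω u f) {t : ℝ} (ht : 0 < t) :
    decRearr n Ω u t ≤ (2 : ℝ) ^ (-(2 / (n : ℝ))) * NstarInf n t * L1norm n Ω f := by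
  have h2 : (0 : ℝ) ≤ 2 ^ (-(2 / (n : ℝ))) := Real.rpow_nonneg zero_le_two _
  refine decRearr_le_of_forall_isTestFun hu (mul_nonneg h2 ?_) fun φ hφ F s hF0 hF hs hsN => ?_
  · exact (NstarV_nonneg (by omega) ht le_rfl).trans (NstarV_le_NstarInf hn ht.le)
  · refine volume_abs_superlevel_le (by omega) hφ.contDiff_two hφ.2.1 (le_max_left _ t) ht
      (le_max_right _ _) hF0 hF hs (le_trans ?_ hsN)
    have := NstarV_le_NstarInf hn (t := t)
      (ht.le.trans (le_max_right (volume.real {x | φ x ≠ 0}) t))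
    gcongr

/-- For Ω ⊆ ℝⁿ (n ≥ 2) open and bounded, every u ∈ W^{2,1}_{Δ,0}(Ω) satisfies
u*(t) ≤ 2^{-2/n} N*_{|Ω|}(t) ‖Δu‖₁ for 0 < t ≤ |Ω|; moreover for n ≥ 3 the same holds for
Ω unbounded, with N*_∞ in place of N*_{|Ω|} when |Ω| = ∞. -/
theorem stmt_1 (n : ℕ) (hn : 2 ≤ n) :
    (∀ Ω : Set (Euc n), IsOpen Ω → Bornology.IsBounded Ω →
      ∀ u f : Euc n → ℝ, MemW21Delta0 n Ω u f →
        ∀ t : ℝ, 0 < t → t ≤ (volume Ω).toReal →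
          decRearr n Ω u t ≤
            (2 : ℝ) ^ (-(2 / (n : ℝ))) * NstarV n (volume Ω).toReal t * L1norm n Ω f) ∧
    (3 ≤ n → ∀ Ω : Set (Euc n), IsOpen Ω →
      ∀ u f : Euc n → ℝ, MemW21Delta0 n Ω u f →
        ∀ t : ℝ, 0 < t → (volume Ω ≠ ⊤ → t ≤ (volume Ω).toReal) →
          decRearr n Ω u t ≤
            (2 : ℝ) ^ (-(2 / (n : ℝ))) *
              (if volume Ω = ⊤ then NstarInf n t else NstarV n (volume Ω).toReal t) *
              L1norm n Ω f) := by
  refine ⟨fun Ω _ hb u f hu t ht htΩ => decRearr_le_NstarV hn hb.measure_lt_top.ne hu ht htΩ,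
    fun hn3 Ω _ u f hu t ht htΩ => ?_⟩
  split_ifs with h
  · exact decRearr_le_NstarInf hn3 hu ht
  · exact decRearr_le_NstarV hn h hu ht (htΩ h)
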